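/- arXiv:1904.04071 — 3 statements merged into one kernel-verified Lean document; each statement's English description precedes it below -/
import Mathlib

section
/- Let n be an odd integer, let i be a positive integer with gcd(i, n) = 1, and let d be a positive integer with 3d ≡ 2^i + 1 (mod 2^n − 1). Then for every u ∈ GF(2^n) ∖ GF(2), the cubic equation (u^d x + (1+u)^d)³ + x³ + 1 = 0 has a unique solution x ∈ GF(2^n). -/
open Finset

noncomputable instance (n : ℕ) : Fintype (GaloisField 2 n) := Fintype.ofFinite _

/-- The absolute trace map from `GF(2^n)` to `GF(2)`. -/
noncomputable def Tr (n : ℕ) (x : GaloisField 2 n) : ZMod 2 :=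
  Algebra.trace (ZMod 2) (GaloisField 2 n) x

/-- The characteristic function of a subset `B ⊆ GF(2^n)`. -/
noncomputable def charFun {n : ℕ} (B : Set (GaloisField 2 n)) (x : GaloisField 2 n) : ZMod 2 :=
  open scoped Classical in if x ∈ B then 1 else 0

/-- The Walsh transform of a Boolean function on `GF(2^n)`, as an integer. -/
noncomputable def walsh {n : ℕ} (f : GaloisField 2 n → ZMod 2) (μ : GaloisField 2 n) : ℤ :=
  ∑ x : GaloisField 2 n, (-1 : ℤ) ^ (f x + Tr n (μ * x)).val

/-- The orbit of a base block `B ⊆ GF(2^n)` under the general affine group `GA₁(2^n)`,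
i.e. the set of all blocks `aB + b` with `a ≠ 0`. -/
def affOrbit {n : ℕ} (B : Set (GaloisField 2 n)) : Set (Set (GaloisField 2 n)) :=
  {S | ∃ a b : GaloisField 2 n, a ≠ 0 ∧ S = (fun x => a * x + b) '' B}

/-- `N_E(a,b,c)`: the number of triples `(x,y,z) ∈ E³` with `ax + by + cz = 0`. -/
noncomputable def NE {n : ℕ} (E : Set (GaloisField 2 n)) (a b c : GaloisField 2 n) : ℕ :=
  Nat.card {t : GaloisField 2 n × GaloisField 2 n × GaloisField 2 n //
    t.1 ∈ E ∧ t.2.1 ∈ E ∧ t.2.2 ∈ E ∧ a * t.1 + b * t.2.1 + c * t.2.2 = 0}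

/-- `I_B(u₁,u₂,u₃)`: the number of pairs `(x,y) ∈ GF(2^n)²` with `uᵢ x + y ∈ B` for `i = 1,2,3`. -/
noncomputable def IB {n : ℕ} (B : Set (GaloisField 2 n)) (u₁ u₂ u₃ : GaloisField 2 n) : ℕ :=
  Nat.card {p : GaloisField 2 n × GaloisField 2 n //
    u₁ * p.1 + p.2 ∈ B ∧ u₂ * p.1 + p.2 ∈ B ∧ u₃ * p.1 + p.2 ∈ B}

/-- The incidence structure `(GF(2^n), affOrbit B)` is a 3-design: there is a `λ` such that
every 3-subset of points lies in exactly `λ` blocks of the orbit. -/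
def Is3Design {n : ℕ} (B : Set (GaloisField 2 n)) : Prop :=
  ∃ lam : ℕ, ∀ u v w : GaloisField 2 n, u ≠ v → u ≠ w → v ≠ w →
    Nat.card {S : Set (GaloisField 2 n) // S ∈ affOrbit B ∧ u ∈ S ∧ v ∈ S ∧ w ∈ S} = lam

/-- In a field with `2 ^ n` elements, `n` odd, cubing has a power map as its inverse. -/
theorem exists_pow_three_mul_eq_self {F : Type*} [Field F] {n : ℕ} (hn : Odd n)
    (hF : ∀ x : F, x ^ 2 ^ n = x) : ∃ m : ℕ, ∀ x : F, x ^ (3 * m) = x := by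
  obtain ⟨k, rfl⟩ := hn
  obtain ⟨m, hm⟩ : 3 ∣ 4 ^ (k + 1) - 1 := by
    simpa using Nat.sub_dvd_pow_sub_pow 4 1 (k + 1)
  have h4 : 3 * m + 1 = 2 ^ (2 * k + 1) * 2 := by
    have h : 2 ^ (2 * k + 1) * 2 = 4 ^ (k + 1) := by
      rw [← pow_succ, show 2 * k + 1 + 1 = 2 * (k + 1) by ring, pow_mul]; norm_num
    have : 1 ≤ 4 ^ (k + 1) := Nat.one_le_pow _ _ (by norm_num)
    omega
  have hm0 : 3 * m ≠ 0 := by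
    have : 1 ≤ 2 ^ (2 * k + 1) := Nat.one_le_pow _ _ (by norm_num)
    omega
  refine ⟨m, fun x => ?_⟩
  by_cases hx : x = 0
  · rw [hx, zero_pow hm0]
  · apply mul_right_cancel₀ hx
    rw [← pow_succ, h4, pow_mul, hF, sq]

/-- In characteristic two, an element fixed by two coprime powers of the Frobenius map lies in the
prime field. -/
theorem eq_zero_or_one_of_pow_two_pow_eq_self {F : Type*} [Field F] [CharP F 2] {m n : ℕ}
    (h : Nat.Coprime m n) {u : F} (hm : u ^ 2 ^ m = u) (hn : u ^ 2 ^ n = u) : u = 0 ∨ u = 1 := by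
  have key : ∀ k, u ^ 2 ^ k = u → Function.IsPeriodicPt (frobenius F 2) k u := fun k hk => by
    rw [Function.IsPeriodicPt, Function.IsFixedPt, iterate_frobenius, hk]
  have h1 := (key m hm).gcd (key n hn)
  rw [h, Function.IsPeriodicPt, Function.IsFixedPt, iterate_frobenius, pow_one] at h1
  have h2 : u * (u - 1) = 0 := by linear_combination h1
  exact (mul_eq_zero.mp h2).imp_right sub_eq_zero.mp

/-- A cubic of the form `(A x + B)³ + x³ + 1` in characteristic two is, for
`A³ = u v` and `B³ = (1 + u) (1 + v)`, proportional to a sum of two cubes. -/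
theorem cubic_eq_add_cubes {F : Type*} [Field F] [CharP F 2] {u v A B e f : F}
    (hA0 : A ≠ 0) (hu1 : 1 + u ≠ 0) (hv1 : 1 + v ≠ 0)
    (hA : A ^ 3 = u * v) (hB : B ^ 3 = (1 + u) * (1 + v))
    (he : e = u * B / (A * (1 + u))) (hf : f = v * B / (A * (1 + v))) (x : F) :
    (u + v) * ((A * x + B) ^ 3 + x ^ 3 + 1) =
      v * (1 + u) ^ 2 * (x + e) ^ 3 + u * (1 + v) ^ 2 * (x + f) ^ 3 := by
  have h2 : (2 : F) = 0 := CharTwo.two_eq_zero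
  have aux : ∀ s t g : F, 1 + s ≠ 0 → A ^ 3 = s * t → B ^ 3 = (1 + s) * (1 + t) →
      g = s * B / (A * (1 + s)) → t * (1 + s) ^ 2 * g = A ^ 2 * B * (1 + s) ∧
        t * (1 + s) ^ 2 * g ^ 2 = s * A * B ^ 2 ∧
        t * (1 + s) ^ 2 * g ^ 3 = s ^ 2 * (1 + t) := by
    rintro s t g hs h3 h4 rfl
    refine ⟨?_, ?_, ?_⟩
    · field_simp
      linear_combination -B * h3
    · field_simp
      linear_combination -s * B ^ 2 * h3
    · field_simp
      linear_combination -s ^ 2 * (1 + s) * (1 + t) * h3 + s ^ 3 * t * h4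
  obtain ⟨p1, p2, p3⟩ := aux u v e hu1 hA hB he
  obtain ⟨q1, q2, q3⟩ := aux v u f hv1 (by rw [hA, mul_comm]) (by rw [hB, mul_comm]) hf
  linear_combination (u + v) * x ^ 3 * hA + (u + v) * hB - 3 * x ^ 2 * (p1 + q1)
    - 3 * x * (p2 + q2) - (p3 + q3)
    + (-2 * u * v * x ^ 3 + (u + v + u * v) - 3 * A ^ 2 * B * x ^ 2) * h2

theorem existsUnique_cubic_root {F : Type*} [Field F] [CharP F 2] {u v A B : F}
    (hcube : Function.Bijective fun x : F => x ^ 3)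
    (hu0 : u ≠ 0) (hv0 : v ≠ 0) (hu1 : 1 + u ≠ 0) (hv1 : 1 + v ≠ 0)
    (huv : u ≠ v) (huv1 : u * v ≠ 1)
    (hA : A ^ 3 = u * v) (hB : B ^ 3 = (1 + u) * (1 + v)) :
    ∃! x : F, (A * x + B) ^ 3 + x ^ 3 + 1 = 0 := by
  have hA0 : A ≠ 0 := by
    rintro rfl
    exact mul_ne_zero hu0 hv0 (by rw [← hA]; ring)
  have hs : u + v ≠ 0 := fun h => huv (CharTwo.add_eq_zero.mp h)
  have hN : u * v + 1 ≠ 0 := fun h => huv1 (CharTwo.add_eq_zero.mp h)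
  obtain ⟨k, hk⟩ := hcube.2 (v * (1 + u) ^ 2 / (u * (1 + v) ^ 2))
  have hc : u * (1 + v) ^ 2 ≠ 0 := mul_ne_zero hu0 (pow_ne_zero 2 hv1)
  have hk3 : k ^ 3 * (u * (1 + v) ^ 2) = v * (1 + u) ^ 2 := by
    rw [show k ^ 3 = _ from hk, div_mul_cancel₀ _ hc]
  have h2 : (2 : F) = 0 := CharTwo.two_eq_zero
  have hk1 : k + 1 ≠ 0 := by
    intro h
    obtain rfl := CharTwo.add_eq_zero.mp h
    refine mul_ne_zero hN hs ?_
    linear_combination -hk3 + (u + u * v ^ 2) * h2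
  set e := u * B / (A * (1 + u)) with he
  set f := v * B / (A * (1 + v)) with hf
  have key : ∀ x : F, (A * x + B) ^ 3 + x ^ 3 + 1 = 0 ↔ x = (f + k * e) / (k + 1) := by
    intro x
    have hcub : (u + v) * ((A * x + B) ^ 3 + x ^ 3 + 1) =
        u * (1 + v) ^ 2 * ((k * (x + e)) ^ 3 + (x + f) ^ 3) := by
      rw [cubic_eq_add_cubes hA0 hu1 hv1 hA hB he hf x, ← hk3]
      ring
    rw [← mul_right_inj' hs, mul_zero, hcub, mul_eq_zero, or_iff_right hc,
      CharTwo.add_eq_zero, show (k * (x + e)) ^ 3 = (x + f) ^ 3 ↔ k * (x + e) = x + f from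
        hcube.1.eq_iff, eq_div_iff hk1]
    constructor
    · intro h
      linear_combination h + (x - k * e) * h2
    · intro h
      linear_combination h + (k * e - x) * h2
  exact ⟨_, (key _).mpr rfl, fun y hy => (key y).mp hy⟩

/-- Lemma 4.4: for odd `n`, `gcd(i,n) = 1` and `3d ≡ 2^i + 1 (mod 2^n - 1)`, the cubic
`(u^d x + (1+u)^d)³ + x³ + 1 = 0` has a unique solution for every `u ∈ GF(2^n) ∖ GF(2)`. -/
theorem stmt_13 (n i d : ℕ) (hn : Odd n) (hi : 0 < i) (hgcd : Nat.gcd i n = 1)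
    (hd : 0 < d) (hcong : 3 * d ≡ 2 ^ i + 1 [MOD 2 ^ n - 1])
    (u : GaloisField 2 n) (hu0 : u ≠ 0) (hu1 : u ≠ 1) :
    ∃! x : GaloisField 2 n, (u ^ d * x + (1 + u) ^ d) ^ 3 + x ^ 3 + 1 = 0 := by
  have hF : ∀ x : GaloisField 2 n, x ^ 2 ^ n = x := fun x => by
    rw [← GaloisField.card 2 n hn.pos.ne', Nat.card_eq_fintype_card]
    exact FiniteField.pow_card x
  have hcube : Function.Bijective fun x : GaloisField 2 n => x ^ 3 := by
    obtain ⟨m, hm⟩ := exists_pow_three_mul_eq_self hn hF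
    refine Function.bijective_iff_has_inverse.mpr ⟨fun x => x ^ m, fun x => ?_, fun x => ?_⟩
    · simpa only [← pow_mul] using hm x
    · simpa only [← pow_mul, mul_comm] using hm x
  have hpow : ∀ x : GaloisField 2 n, x ≠ 0 → (x ^ d) ^ 3 = x * x ^ 2 ^ i := fun x hx => by
    have h1 : x ^ (2 ^ n - 1) = 1 := mul_right_cancel₀ hx (by
      rw [← pow_succ, Nat.sub_add_cancel Nat.one_le_two_pow, hF, one_mul])
    rw [← pow_mul, ← pow_succ', mul_comm d, pow_eq_pow_mod _ h1, hcong, ← pow_eq_pow_mod _ h1]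
  have hfix : ∀ m, Nat.Coprime m n → u ^ 2 ^ m ≠ u := fun m hm h =>
    (eq_zero_or_one_of_pow_two_pow_eq_self hm h (hF u)).elim hu0 hu1
  have hu1' : 1 + u ≠ 0 := fun h => hu1 (CharTwo.add_eq_zero.mp h).symm
  have hadd : (1 + u) ^ 2 ^ i = 1 + u ^ 2 ^ i := by rw [add_pow_char_pow, one_pow]
  refine existsUnique_cubic_root hcube hu0 (pow_ne_zero (2 ^ i) hu0) hu1'
    (hadd ▸ pow_ne_zero _ hu1') (hfix i hgcd).symm ?_ (hpow u hu0) (hadd ▸ hpow (1 + u) hu1')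
  intro h
  refine hfix (i + i) ?_ ?_
  · rw [← two_mul]
    exact Nat.Coprime.mul_left (Nat.coprime_two_left.mpr hn) hgcd
  · have hv := eq_inv_of_mul_eq_one_right h
    rw [pow_add, pow_mul, hv, inv_pow, hv, inv_inv]
end

section
/- Let i be an even positive integer, let n = 3i + 1 or n = 3i − 1, q = 2^n, and s = 2^{2i} − 2^i + 1. Let d be the multiplicative inverse of s modulo 2^n − 1, and let B_s = {(x+1)^s + x^s : x ∈ GF(q)}. Then for all μ ∈ GF(q), f̂_{B_s}(μ) = Σ_{x ∈ GF(q)} (−1)^{Tr(x^{2^i+1} + μ^d x)}; equivalently, f̂_{B_s}(μ) = f̂_E(μ^d) where E = {x ∈ GF(q) : Tr(x^{2^i+1}) = 1}. -/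
open Finset

theorem neg_one_pow_val_add (u v : ZMod 2) :
    (-1 : ℤ) ^ (u + v).val = (-1) ^ u.val * (-1) ^ v.val := by
  revert u v; decide

theorem coprime_two_pow_add_one {i n : ℕ} (h : Nat.gcd (2 * i) n = 1) :
    (2 ^ i + 1).Coprime (2 ^ n - 1) := by
  have h1 := Nat.pow_sub_one_gcd_pow_sub_one 2 (2 * i) n
  rw [h] at h1
  refine Nat.Coprime.coprime_dvd_left ⟨2 ^ i - 1, ?_⟩ h1
  rw [mul_comm 2 i, pow_mul, ← Nat.sq_sub_sq, one_pow]

theorem kasami_exponent_mul (i : ℕ) :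
    (2 ^ i + 1) * (2 ^ (2 * i) - 2 ^ i + 1) = 2 ^ (3 * i) + 1 := by
  have hQ : 2 ^ (2 * i) = 2 ^ i * 2 ^ i := by ring
  have hQ3 : 2 ^ (3 * i) = 2 ^ i * 2 ^ i * 2 ^ i := by ring
  rw [hQ, hQ3]
  obtain ⟨k, hk⟩ := Nat.exists_eq_add_of_le' (Nat.one_le_two_pow (n := i))
  rw [hk]
  have : (k + 1) * (k + 1) - (k + 1) = k * (k + 1) := by
    rw [Nat.sub_eq_iff_eq_add (by nlinarith)]; ring
  rw [this]; ring

theorem pow_pow_eq_self_of_modEq {K : Type*} [Field K] [Fintype K] {n s d : ℕ}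
    (hK : Fintype.card K = 2 ^ n)
    (h0 : s * d ≠ 0) (h : s * d ≡ 1 [MOD 2 ^ n - 1]) (x : K) : (x ^ s) ^ d = x := by
  rw [← pow_mul]
  by_cases hx : x = 0
  · rw [hx, zero_pow h0]
  · rw [pow_eq_pow_of_modEq h (hK ▸ FiniteField.pow_card_sub_one_eq_one x hx), pow_one]

theorem bijective_pow_of_coprime {K : Type*} [Field K] [Fintype K] {n m : ℕ}
    (hK : Fintype.card K = 2 ^ n) (hn : 1 < n)
    (h : m.Coprime (2 ^ n - 1)) : Function.Bijective fun x : K => x ^ m := by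
  have h1 : 1 < 2 ^ n - 1 := by
    have := Nat.pow_le_pow_right (n := 2) (by norm_num) hn
    omega
  obtain ⟨e, -, he⟩ := Nat.exists_mul_mod_eq_one_of_coprime h h1
  have h0 : m * e ≠ 0 := fun h0 => by simp [h0] at he
  have he' : m * e ≡ 1 [MOD 2 ^ n - 1] := by rw [Nat.ModEq, he, Nat.mod_eq_of_lt h1]
  exact Finite.injective_iff_bijective.1
    (Function.LeftInverse.injective (g := fun x => x ^ e) (pow_pow_eq_self_of_modEq hK h0 he'))

section CharTwoField

variable {K : Type*} [Field K] [Algebra (ZMod 2) K]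

/-- The canonical additive character `x ↦ (-1) ^ Tr x` of a finite field of characteristic two,
with values in `ℤ`. -/
noncomputable def traceSign (x : K) : ℤ := (-1) ^ (Algebra.trace (ZMod 2) K x).val

theorem traceSign_zero : traceSign (0 : K) = 1 := by simp [traceSign]

theorem traceSign_add (x y : K) : traceSign (x + y) = traceSign x * traceSign y := by
  simp [traceSign, neg_one_pow_val_add]

theorem traceSign_mul_self (x : K) : traceSign x * traceSign x = 1 := by
  rw [traceSign, ← mul_pow]; simp

theorem traceSign_eq_or (x : K) : traceSign x = 1 ∨ traceSign x = -1 :=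
  neg_one_pow_eq_or ℤ _

theorem traceSign_algEquiv (σ : K ≃ₐ[ZMod 2] K) (x : K) : traceSign (σ x) = traceSign x := by
  rw [traceSign, Algebra.trace_eq_of_algEquiv, traceSign]

theorem traceSign_mul_algEquiv_self_of_cube {σ : K ≃ₐ[ZMod 2] K} (hσ : ∀ x, σ (σ (σ x)) = x ^ 2)
    {a p q r : K} (hp : p ≠ 0) (hpq : σ p = q) (hqr : σ q = r)
    (ha : a * (r * p ^ 2) = p ^ 3 + q ^ 3 + r ^ 3 + 1) :
    traceSign (a * σ a) = 1 := by
  have : CharP K 2 := charP_of_injective_algebraMap (algebraMap (ZMod 2) K).injective 2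
  have hq : q ≠ 0 := by rw [← hpq]; simpa using hp
  have hr : r ≠ 0 := by rw [← hqr]; simpa using hq
  have hrp : σ r = p ^ 2 := by rw [← hqr, ← hpq, hσ]
  have ha' : a = (p ^ 3 + q ^ 3 + r ^ 3 + 1) / (r * p ^ 2) := by
    field_simp; linear_combination ha
  set h : K := (1 + r ^ 3) / (p * q ^ 2 * r) + p ^ 5 / (q ^ 2 * r) + p ^ 2 * q / r + q / (p * r) with hh
  have e : a * σ a = h + σ (σ h) := by
    rw [hh, ha']
    simp only [map_add, map_mul, map_div₀, map_pow, map_one, hpq, hqr, hrp]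
    field_simp
    have h2 := CharTwo.two_eq_zero (R := K)
    linear_combination (q ^ 3 * r ^ 3 + q ^ 3 + r ^ 3) * h2
  rw [e, traceSign_add, traceSign_algEquiv, traceSign_algEquiv, traceSign_mul_self]

theorem traceSign_cubic_form_of_radical {σ : K ≃ₐ[ZMod 2] K} (hσ : ∀ x, σ (σ (σ x)) = x ^ 2)
    {a z : K} (ha : traceSign (a * σ a) = -1)
    (hz : z ^ 2 + σ.symm (σ.symm (σ.symm z)) + a * σ z + σ.symm (a * z) = 0) :
    traceSign (z ^ 3 + a * (z * σ z)) = 1 := by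
  have : CharP K 2 := charP_of_injective_algebraMap (algebraMap (ZMod 2) K).injective 2
  by_cases hz0 : z = 0
  · simp [hz0, traceSign_zero]
  obtain ⟨p, rfl⟩ : ∃ p, σ (σ p) = z := ⟨σ.symm (σ.symm z), by simp⟩
  have h2 := CharTwo.two_eq_zero (R := K)
  have hz' := congrArg σ hz
  simp only [map_add, map_mul, map_pow, AlgEquiv.apply_symm_apply, AlgEquiv.symm_apply_apply,
    map_zero, hσ] at hz' ⊢
  set q := σ p with hq
  set r := σ q with hr
  have hrp : σ r = p ^ 2 := hσ p
  have hp : p ≠ 0 := fun h => hz0 (by rw [hr, hq, h]; simp)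
  set e := a * (r * p ^ 2) + (p ^ 3 + q ^ 3 + r ^ 3) with he
  have hfix : σ e = e := by
    rw [he]
    simp only [map_add, map_mul, map_pow, ← hq, ← hr, hrp]
    linear_combination p ^ 2 * hz' - (a * r * p ^ 2 + p ^ 3) * h2
  have he2 : e * (e - 1) = 0 := by
    have := hσ e
    rw [hfix, hfix, hfix] at this
    linear_combination -this
  have hval : traceSign (r ^ 3 + a * (r * p ^ 2)) = traceSign e := by
    have h1 : traceSign (q ^ 3) = traceSign (p ^ 3) := by
      rw [hq, ← map_pow, traceSign_algEquiv]
    rw [he]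
    simp only [traceSign_add, h1]
    linear_combination -traceSign (r ^ 3) * traceSign (a * (r * p ^ 2)) *
      traceSign_mul_self (p ^ 3)
  rw [hval]
  rcases mul_eq_zero.1 he2 with h0 | h1
  · rw [h0, traceSign_zero]
  · have := traceSign_mul_algEquiv_self_of_cube hσ (a := a) hp hq.symm hr.symm (by
      linear_combination h1 - he - (p ^ 3 + q ^ 3 + r ^ 3) * h2)
    omega

variable [Fintype K]

theorem sum_traceSign_mul [DecidableEq K] (c : K) :
    ∑ x : K, traceSign (c * x) = if c = 0 then (Fintype.card K : ℤ) else 0 := by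
  split_ifs with hc
  · simp [hc, traceSign_zero]
  · obtain ⟨y, hy⟩ : ∃ y : K, traceSign (c * y) = -1 := by
      by_contra! h
      refine hc ((traceForm_nondegenerate (ZMod 2) K).1 c fun y => ?_)
      rw [Algebra.traceForm_apply]
      have h1 := (traceSign_eq_or (c * y)).resolve_right (h y)
      rw [traceSign] at h1
      generalize Algebra.trace (ZMod 2) K (c * y) = t at h1 ⊢
      revert t
      decide
    have h := Fintype.sum_equiv (Equiv.addRight y) (fun x => traceSign (c * (x + y)))
      (fun x => traceSign (c * x)) (fun x => rfl)
    simp only [mul_add, traceSign_add, hy, mul_neg, mul_one, Finset.sum_neg_distrib] at h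
    omega

theorem sum_traceSign_bijective {f : K → K} (hf : Function.Bijective f) :
    ∑ x : K, traceSign (f x) = 0 := by
  classical
  rw [Fintype.sum_bijective f hf _ (fun x => traceSign (1 * x)) (fun x => by rw [one_mul]),
    sum_traceSign_mul, if_neg one_ne_zero]

theorem sum_sq_sum_mul_traceSign [DecidableEq K] (u : K → ℤ) (g : K → K) :
    ∑ c : K, (∑ x : K, u x * traceSign (c * g x)) ^ 2
      = Fintype.card K * ∑ x : K, ∑ y : K, if g x = g y then u x * u y else 0 := by
  have : CharP K 2 := charP_of_injective_algebraMap (algebraMap (ZMod 2) K).injective 2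
  simp only [sq, Finset.sum_mul_sum]
  rw [Finset.sum_comm, Finset.mul_sum]
  refine Finset.sum_congr rfl fun x _ => ?_
  rw [Finset.sum_comm, Finset.mul_sum]
  refine Finset.sum_congr rfl fun y _ => ?_
  have h : ∀ c : K, u x * traceSign (c * g x) * (u y * traceSign (c * g y))
      = u x * u y * traceSign ((g x + g y) * c) := fun c => by
    rw [add_mul, traceSign_add, mul_comm c, mul_comm c]; ring
  simp only [h, ← Finset.mul_sum, sum_traceSign_mul, CharTwo.add_eq_zero]
  split_ifs <;> ring

/-- Parseval's identity. -/
theorem sum_sq_sum_traceSign (f : K → K) :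
    ∑ c : K, (∑ x : K, traceSign (f x + c * x)) ^ 2 = (Fintype.card K : ℤ) ^ 2 := by
  classical
  simp only [traceSign_add]
  have h := sum_sq_sum_mul_traceSign (fun x => traceSign (f x)) id
  simpa [traceSign_mul_self, ← sq (Fintype.card K : ℤ)] using h

theorem sum_sq_mul_traceSign (f : K → K) (v : K) :
    ∑ c : K, (∑ x : K, traceSign (f x + c * x)) ^ 2 * traceSign (v * c)
      = Fintype.card K * ∑ x : K, traceSign (f (x + v) + f x) := by
  classical
  have : CharP K 2 := charP_of_injective_algebraMap (algebraMap (ZMod 2) K).injective 2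
  simp only [sq, Finset.sum_mul_sum]
  simp only [Finset.sum_mul]
  rw [Finset.sum_comm, Finset.mul_sum]
  refine Finset.sum_congr rfl fun x _ => ?_
  rw [Finset.sum_comm]
  have h : ∀ y c : K, traceSign (f x + c * x) * traceSign (f y + c * y) * traceSign (v * c)
      = traceSign (f x) * traceSign (f y) * traceSign ((x + v + y) * c) := fun y c => by
    simp only [add_mul, traceSign_add, mul_comm c]; ring
  simp only [h, ← Finset.mul_sum, sum_traceSign_mul, CharTwo.add_eq_zero]
  simp [traceSign_add]
  ring

theorem sq_sum_cubic_form {σ : K ≃ₐ[ZMod 2] K} (hσ : ∀ x, σ (σ (σ x)) = x ^ 2) (a : K)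
    [DecidableEq K] :
    (∑ y : K, traceSign (y ^ 3 + a * (y * σ y))) ^ 2
      = Fintype.card K * ∑ z : K,
        if z ^ 2 + σ.symm (σ.symm (σ.symm z)) + a * σ z + σ.symm (a * z) = 0
          then traceSign (z ^ 3 + a * (z * σ z)) else 0 := by
  have : CharP K 2 := charP_of_injective_algebraMap (algebraMap (ZMod 2) K).injective 2
  have key : ∀ y z : K, traceSign (y ^ 3 + a * (y * σ y)) *
      traceSign ((z + y) ^ 3 + a * ((z + y) * σ (z + y)))
      = traceSign (z ^ 3 + a * (z * σ z)) * traceSign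
        ((z ^ 2 + σ.symm (σ.symm (σ.symm z)) + a * σ z + σ.symm (a * z)) * y) := by
    intro y z
    have e1 : traceSign (σ.symm (σ.symm (σ.symm z)) * y) = traceSign (z * y ^ 2) := by
      rw [← hσ y, ← traceSign_algEquiv σ, ← traceSign_algEquiv σ, ← traceSign_algEquiv σ]
      simp
    have e2 : traceSign (σ.symm (a * z) * y) = traceSign (a * z * σ y) := by
      rw [← traceSign_algEquiv σ]; simp
    have e3 : (z + y) ^ 3 + a * ((z + y) * σ (z + y)) =
        (z ^ 3 + a * (z * σ z)) + (y ^ 3 + a * (y * σ y)) +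
        (z ^ 2 * y + z * y ^ 2 + a * σ z * y + a * z * σ y) := by
      rw [map_add]
      linear_combination (z ^ 2 * y + z * y ^ 2) * CharTwo.two_eq_zero (R := K)
    rw [e3]
    have h := traceSign_mul_self (y ^ 3 + a * (y * σ y))
    simp only [add_mul, traceSign_add, e1, e2] at h ⊢
    linear_combination traceSign (z ^ 3) * traceSign (a * (z * σ z)) * traceSign (z ^ 2 * y) *
      traceSign (z * y ^ 2) * traceSign (a * σ z * y) * traceSign (a * z * σ y) * h
  have shift : ∀ y : K, ∑ x : K, traceSign (x ^ 3 + a * (x * σ x))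
      = ∑ z : K, traceSign ((z + y) ^ 3 + a * ((z + y) * σ (z + y))) := fun y =>
    (Fintype.sum_equiv (Equiv.addRight y) _ _ fun z => rfl).symm
  calc (∑ y : K, traceSign (y ^ 3 + a * (y * σ y))) ^ 2
      = ∑ y : K, ∑ z : K, traceSign (y ^ 3 + a * (y * σ y)) *
          traceSign ((z + y) ^ 3 + a * ((z + y) * σ (z + y))) := by
        rw [sq, Finset.sum_mul]
        exact Finset.sum_congr rfl fun y _ => by rw [shift y, Finset.mul_sum]
    _ = _ := by
        simp only [key]
        rw [Finset.sum_comm, Finset.mul_sum]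
        refine Finset.sum_congr rfl fun z _ => ?_
        rw [← Finset.mul_sum, sum_traceSign_mul]
        split_ifs <;> ring

theorem two_mul_card_le_sq_sum_cubic_form {n : ℕ} (hn : Odd n) (hK : Fintype.card K = 2 ^ n)
    {σ : K ≃ₐ[ZMod 2] K} (hσ : ∀ x, σ (σ (σ x)) = x ^ 2) {a : K}
    (ha : traceSign (a * σ a) = -1) :
    2 * (Fintype.card K : ℤ) ≤ (∑ y : K, traceSign (y ^ 3 + a * (y * σ y))) ^ 2 := by
  classical
  have h := sq_sum_cubic_form hσ a
  rw [Finset.sum_congr rfl fun z _ => if_ctx_congr Iff.rfl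
    (traceSign_cubic_form_of_radical hσ ha) fun _ => rfl, Finset.sum_boole] at h
  set R := Finset.univ.filter fun z : K =>
    z ^ 2 + σ.symm (σ.symm (σ.symm z)) + a * σ z + σ.symm (a * z) = 0
  have h0 : 0 < R.card := Finset.card_pos.2 ⟨0, by simp [R]⟩
  have h1 : R.card ≠ 1 := by
    intro h1
    rw [h1, hK] at h
    have h' := congrArg Int.natAbs h
    simp only [Int.natAbs_pow, Nat.cast_one, mul_one, Int.natAbs_natCast] at h'
    obtain ⟨k, -, hk⟩ := (Nat.dvd_prime_pow Nat.prime_two).1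
      (Dvd.intro_left _ ((pow_two _).symm.trans h'))
    rw [hk, ← pow_mul] at h'
    have := Nat.pow_right_injective le_rfl h'
    rcases hn with ⟨m, rfl⟩
    omega
  rw [h, mul_comm]
  have : (2 : ℤ) ≤ R.card := by omega
  gcongr

theorem sum_traceSign_pow_mul_derivative {s : ℕ} (hs : 0 < s) {e : K → K} [DecidableEq K]
    (hW : ∀ a, (∑ x : K, traceSign (x ^ s + a * x)) ^ 2
      = Fintype.card K * (1 - traceSign (e a)))
    (he : ∑ a : K, traceSign (e a) = 0) (v : K) :
    ∑ x : K, traceSign (v ^ s * ((x + 1) ^ s + x ^ s))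
      = (if v = 0 then (Fintype.card K : ℤ) else 0) - ∑ x : K, traceSign (e x + v * x) := by
  have : CharP K 2 := charP_of_injective_algebraMap (algebraMap (ZMod 2) K).injective 2
  by_cases hv : v = 0
  · simp [hv, hs.ne', traceSign_zero, he]
  rw [← sum_traceSign_mul]
  have hq : (Fintype.card K : ℤ) ≠ 0 := by simp
  apply mul_left_cancel₀ hq
  calc (Fintype.card K : ℤ) * ∑ x : K, traceSign (v ^ s * ((x + 1) ^ s + x ^ s))
      = Fintype.card K * ∑ x : K, traceSign ((x + v) ^ s + x ^ s) := by
        congr 1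
        refine Fintype.sum_equiv (Equiv.mulLeft₀ v hv) _ _ fun x => ?_
        change _ = traceSign ((v * x + v) ^ s + (v * x) ^ s)
        rw [mul_add, ← mul_pow, ← mul_pow, mul_add, mul_one]
    _ = _ := by
        rw [← sum_sq_mul_traceSign (fun x => x ^ s) v, ← Finset.sum_sub_distrib, Finset.mul_sum]
        refine Finset.sum_congr rfl fun c _ => ?_
        rw [hW, traceSign_add]
        ring

theorem card_fiber_pow_derivative {s : ℕ} (hs : 0 < s)
    (hbij : Function.Bijective fun x : K => x ^ s) {e : K → K} [DecidableEq K]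
    (hW : ∀ a, (∑ x : K, traceSign (x ^ s + a * x)) ^ 2
      = Fintype.card K * (1 - traceSign (e a)))
    (he : ∑ a : K, traceSign (e a) = 0) (x : K) :
    #{y : K | (x + 1) ^ s + x ^ s = (y + 1) ^ s + y ^ s} = 2 := by
  have : CharP K 2 := charP_of_injective_algebraMap (algebraMap (ZMod 2) K).injective 2
  have hle : ∀ x ∈ (univ : Finset K),
      2 ≤ #{y : K | (x + 1) ^ s + x ^ s = (y + 1) ^ s + y ^ s} := fun x _ => by
    rw [← Finset.card_pair (a := x) (b := x + 1) (by simp)]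
    refine Finset.card_le_card fun y hy => ?_
    rcases Finset.mem_insert.1 hy with rfl | hy
    · simp
    · rw [Finset.mem_singleton.1 hy]
      simp [add_assoc, CharTwo.add_self_eq_zero, add_comm (x ^ s)]
  refine ((Finset.sum_eq_sum_iff_of_le hle).1 ?_ x (Finset.mem_univ x)).symm
  have hq : (Fintype.card K : ℤ) ≠ 0 := by simp
  have h1 := sum_sq_sum_mul_traceSign (fun _ : K => (1 : ℤ)) fun x => (x + 1) ^ s + x ^ s
  have h2 : ∑ c : K, (∑ x : K, 1 * traceSign (c * ((x + 1) ^ s + x ^ s))) ^ 2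
      = ∑ v : K, ((if v = 0 then (Fintype.card K : ℤ) else 0)
        - ∑ x : K, traceSign (e x + v * x)) ^ 2 := by
    refine (Fintype.sum_bijective _ hbij _ _ fun v => ?_).symm
    simp only [one_mul]
    rw [sum_traceSign_pow_mul_derivative hs hW he]
  have h3 : ∑ v : K, ((if v = 0 then (Fintype.card K : ℤ) else 0)
      - ∑ x : K, traceSign (e x + v * x)) ^ 2 = 2 * (Fintype.card K : ℤ) ^ 2 := by
    simp only [sub_sq, Finset.sum_add_distrib, Finset.sum_sub_distrib]
    rw [sum_sq_sum_traceSign]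
    simp [ite_pow, he]
    ring
  rw [h2, h3] at h1
  have h4 : 2 * (Fintype.card K : ℤ) = ∑ x : K, ∑ y : K,
      if (x + 1) ^ s + x ^ s = (y + 1) ^ s + y ^ s then 1 * 1 else 0 := by
    apply mul_left_cancel₀ hq
    rw [← h1]; ring
  simp only [mul_one, Finset.sum_boole] at h4
  simp only [Finset.sum_const, Finset.card_univ, smul_eq_mul]
  zify
  linarith

theorem sum_sign_image_pow_derivative {s : ℕ} (hs : 0 < s)
    (hbij : Function.Bijective fun x : K => x ^ s) {e : K → K}
    (hW : ∀ a, (∑ x : K, traceSign (x ^ s + a * x)) ^ 2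
      = Fintype.card K * (1 - traceSign (e a)))
    (he : ∑ a : K, traceSign (e a) = 0)
    (ε : K → ℤ) (hε : ∀ y, (∃ x, y = (x + 1) ^ s + x ^ s) → ε y = -1)
    (hε' : ∀ y, (¬ ∃ x, y = (x + 1) ^ s + x ^ s) → ε y = 1) (v : K) :
    ∑ y : K, ε y * traceSign (v ^ s * y) = ∑ x : K, traceSign (e x + v * x) := by
  classical
  have hN : ∀ y, (#{x : K | (x + 1) ^ s + x ^ s = y} : ℤ) = 1 - ε y := fun y => by
    by_cases hy : ∃ x, y = (x + 1) ^ s + x ^ s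
    · rw [hε y hy]
      obtain ⟨x, rfl⟩ := hy
      simp only [eq_comm (b := (x + 1) ^ s + x ^ s)]
      rw [card_fiber_pow_derivative hs hbij hW he]
      norm_num
    · rw [hε' y hy]
      rw [sub_self, Nat.cast_eq_zero, Finset.card_eq_zero, Finset.filter_eq_empty_iff]
      exact fun x _ hx => hy ⟨x, hx.symm⟩
  have h1 : ∑ x : K, traceSign (v ^ s * ((x + 1) ^ s + x ^ s))
      = ∑ y : K, (1 - ε y) * traceSign (v ^ s * y) := by
    rw [← Finset.sum_fiberwise (univ : Finset K) fun x => (x + 1) ^ s + x ^ s]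
    refine Finset.sum_congr rfl fun y _ => ?_
    rw [Finset.sum_congr rfl fun x hx => by rw [(Finset.mem_filter.1 hx).2], Finset.sum_const,
      ← hN, nsmul_eq_mul]
  rw [sum_traceSign_pow_mul_derivative hs hW he] at h1
  simp only [sub_mul, one_mul, Finset.sum_sub_distrib, sum_traceSign_mul,
    pow_eq_zero_iff hs.ne'] at h1
  linarith

theorem exists_algEquiv_pow_two_pow (i : ℕ) : ∃ σ : K ≃ₐ[ZMod 2] K, ∀ x, σ x = x ^ 2 ^ i :=
  ⟨FiniteField.frobeniusAlgEquivOfAlgebraic (ZMod 2) K ^ i, fun x => by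
    rw [AlgEquiv.coe_pow, FiniteField.coe_frobeniusAlgEquivOfAlgebraic_iterate, ZMod.card]⟩

/-- For `n = 3i ± 1`, a Kasami exponential sum reduces to a cubic one, after composing with
a generator of the Galois group which is a cube root of the Frobenius. -/
theorem exists_algEquiv_cubic_form {n i : ℕ} (hK : Fintype.card K = 2 ^ n) (hi : 0 < i)
    (hn : n = 3 * i + 1 ∨ n = 3 * i - 1) :
    ∃ τ : K ≃ₐ[ZMod 2] K, (∀ x, τ (τ (τ x)) = x ^ 2) ∧ ∀ a : K, ∃ b : K,
      traceSign (b * τ b) = traceSign (a ^ (2 ^ i + 1)) ∧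
      ∀ y, traceSign (y ^ 3 + b * (y * τ y))
        = traceSign (y ^ (2 ^ (3 * i) + 1) + a * y ^ (2 ^ i + 1)) := by
  obtain ⟨σ, hσ⟩ := exists_algEquiv_pow_two_pow (K := K) i
  have hσ3 : ∀ x, σ (σ (σ x)) = x ^ 2 ^ (3 * i) := fun x => by
    simp only [hσ, ← pow_mul]
    congr 1; ring
  have hcard : ∀ x : K, x ^ 2 ^ n = x := fun x => hK ▸ FiniteField.pow_card x
  rcases hn with hn | hn
  · have hτ : ∀ x, σ.symm (σ.symm (σ.symm x)) = x ^ 2 := fun x => by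
      obtain ⟨y, rfl⟩ : ∃ y, σ (σ (σ y)) = x := ⟨σ.symm (σ.symm (σ.symm x)), by simp⟩
      simp only [AlgEquiv.symm_apply_apply]
      rw [hσ3, ← pow_mul, ← pow_succ, ← hn, hcard]
    refine ⟨σ.symm, hτ, fun a => ⟨σ.symm a, ?_, fun y => ?_⟩⟩
    · rw [← map_mul, traceSign_algEquiv, ← traceSign_algEquiv σ, map_mul,
        AlgEquiv.apply_symm_apply, hσ, pow_succ]
    · have h1 : traceSign (y ^ (2 ^ (3 * i) + 1)) = traceSign (y ^ 3) := by
        rw [← traceSign_algEquiv σ.symm, ← traceSign_algEquiv σ.symm, ← traceSign_algEquiv σ.symm,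
          hτ, pow_succ y, mul_pow, ← pow_mul, ← pow_succ, ← hn, hcard, ← pow_succ']
      have h2 : traceSign (σ.symm a * (y * σ.symm y)) = traceSign (a * y ^ (2 ^ i + 1)) := by
        rw [← traceSign_algEquiv σ]
        simp only [map_mul, AlgEquiv.apply_symm_apply]
        rw [hσ, pow_succ]
      rw [traceSign_add, traceSign_add, h1, h2]
  · have h3 : 3 * i = n + 1 := by omega
    have hτ : ∀ x, σ (σ (σ x)) = x ^ 2 := fun x => by
      rw [hσ3, h3, pow_succ, pow_mul, hcard]
    refine ⟨σ, hτ, fun a => ⟨a, by rw [hσ, pow_succ, mul_comm], fun y => ?_⟩⟩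
    rw [pow_succ y (2 ^ (3 * i)), ← hσ3, hτ, ← pow_succ, hσ, pow_succ y (2 ^ i), mul_comm y]

/-- The squared Walsh spectrum of the Kasami power function when `n = 3i ± 1` is odd. -/
theorem sq_sum_kasami {n i : ℕ} (hK : Fintype.card K = 2 ^ n) (hi : 0 < i)
    (hn : n = 3 * i + 1 ∨ n = 3 * i - 1) (hodd : Odd n)
    (hbij : Function.Bijective fun x : K => x ^ (2 ^ i + 1)) (a : K) :
    (∑ x : K, traceSign (x ^ (2 ^ (2 * i) - 2 ^ i + 1) + a * x)) ^ 2
      = Fintype.card K * (1 - traceSign (a ^ (2 ^ i + 1))) := by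
  classical
  obtain ⟨τ, hτ, hform⟩ := exists_algEquiv_cubic_form hK hi hn
  have hle : ∀ a ∈ (univ : Finset K), (Fintype.card K : ℤ) * (1 - traceSign (a ^ (2 ^ i + 1)))
      ≤ (∑ x : K, traceSign (x ^ (2 ^ (2 * i) - 2 ^ i + 1) + a * x)) ^ 2 := fun a _ => by
    rcases traceSign_eq_or (a ^ (2 ^ i + 1)) with h | h
    · rw [h, sub_self, mul_zero]; positivity
    · obtain ⟨b, hb, hab⟩ := hform a
      have h1 : ∑ x : K, traceSign (x ^ (2 ^ (2 * i) - 2 ^ i + 1) + a * x)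
          = ∑ y : K, traceSign (y ^ 3 + b * (y * τ y)) := by
        refine (Fintype.sum_bijective _ hbij _ _ fun y => ?_).symm
        rw [hab, ← pow_mul, kasami_exponent_mul]
      have h2 := two_mul_card_le_sq_sum_cubic_form hodd hK hτ (hb.trans h)
      rw [h1, h]
      linarith
  refine ((Finset.sum_eq_sum_iff_of_le hle).1 ?_ a (Finset.mem_univ a)).symm
  rw [sum_sq_sum_traceSign, ← Finset.mul_sum, Finset.sum_sub_distrib, sum_traceSign_bijective hbij]
  simp [sq]

end CharTwoField

/-- Proposition 4.6: for even `i`, `n = 3i ± 1`, `s = 2^{2i} - 2^i + 1` and `d = 1/s mod 2^n - 1`,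
the Walsh transform of the characteristic function of `B_s = {(x+1)^s + x^s}` satisfies
`f̂_{B_s}(μ) = Σ_x (-1)^{Tr(x^{2^i+1} + μ^d x)} = f̂_E(μ^d)` with `E = {x : Tr(x^{2^i+1}) = 1}`. -/
theorem stmt_15 (n i s d : ℕ) (hi : 0 < i) (hie : Even i)
    (hn : n = 3 * i + 1 ∨ n = 3 * i - 1)
    (hs : s = 2 ^ (2 * i) - 2 ^ i + 1) (hd0 : 0 < d) (hd : s * d ≡ 1 [MOD 2 ^ n - 1])
    (B : Set (GaloisField 2 n))
    (hB : B = {y : GaloisField 2 n | ∃ x : GaloisField 2 n, y = (x + 1) ^ s + x ^ s}) :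
    ∀ μ : GaloisField 2 n,
      walsh (charFun B) μ
        = (∑ x : GaloisField 2 n, (-1 : ℤ) ^ (Tr n (x ^ (2 ^ i + 1) + μ ^ d * x)).val) ∧
      walsh (charFun B) μ
        = walsh (charFun {x : GaloisField 2 n | Tr n (x ^ (2 ^ i + 1)) = 1}) (μ ^ d) := by
  obtain ⟨j, rfl⟩ := hie
  have hodd : Odd n := by
    rcases hn with hn | hn
    · exact ⟨3 * j, by omega⟩
    · exact ⟨3 * j - 1, by omega⟩
  have hn1 : 1 < n := by omega
  have hK : Fintype.card (GaloisField 2 n) = 2 ^ n := by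
    rw [← Nat.card_eq_fintype_card, GaloisField.card 2 n (by omega)]
  have hgcd : Nat.gcd (2 * (j + j)) n = 1 := by
    have h1 := Nat.gcd_dvd_left (2 * (j + j)) n
    have h2 := Nat.gcd_dvd_right (2 * (j + j)) n
    have h3 : Nat.gcd (2 * (j + j)) n ∣ 2 := by
      rcases hn with hn | hn
      · exact (Nat.dvd_add_right (h1.mul_left 3)).1 ((h2.mul_left 2).trans (dvd_of_eq (by omega)))
      · exact (Nat.dvd_add_right (h2.mul_left 2)).1 ((h1.mul_left 3).trans (dvd_of_eq (by omega)))
    rcases (Nat.dvd_prime Nat.prime_two).1 h3 with h | h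
    · exact h
    · rw [h] at h2
      exact absurd h2 hodd.not_two_dvd_nat
  have hs0 : 0 < s := by omega
  have hbij := bijective_pow_of_coprime hK hn1 (coprime_two_pow_add_one hgcd)
  have hsd : ∀ x : GaloisField 2 n, (x ^ s) ^ d = x :=
    pow_pow_eq_self_of_modEq hK (mul_pos hs0 hd0).ne' hd
  have hds : ∀ x : GaloisField 2 n, (x ^ d) ^ s = x :=
    pow_pow_eq_self_of_modEq hK (mul_pos hd0 hs0).ne' (mul_comm s d ▸ hd)
  have hbs : Function.Bijective fun x : GaloisField 2 n => x ^ s :=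
    Function.bijective_iff_has_inverse.2 ⟨fun x => x ^ d, hsd, hds⟩
  have h0 : ∑ a : GaloisField 2 n, traceSign (a ^ (2 ^ (j + j) + 1)) = 0 :=
    sum_traceSign_bijective hbij
  intro μ
  have hmain : walsh (charFun B) μ
      = ∑ x : GaloisField 2 n, traceSign (x ^ (2 ^ (j + j) + 1) + μ ^ d * x) := by
    rw [← sum_sign_image_pow_derivative hs0 hbs (hs ▸ sq_sum_kasami hK hi hn hodd hbij) h0
      (fun y => (-1) ^ (charFun B y).val) (fun y hy => ?_) (fun y hy => ?_), hds]
    · simp only [walsh, neg_one_pow_val_add]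
      rfl
    · have : y ∈ B := hB ▸ hy
      simp [charFun, this, ZMod.val_one]
    · have : y ∉ B := hB ▸ hy
      simp [charFun, this]
  refine ⟨hmain, hmain.trans (Finset.sum_congr rfl fun x _ => ?_)⟩
  rw [traceSign, map_add]
  congr 3
  unfold charFun
  have h01 : ∀ t : ZMod 2, t ≠ 1 → t = 0 := by decide
  split_ifs with h
  · exact h
  · exact h01 _ h
end

section
/- Let n be an odd integer, q = 2^n, and let i be a positive integer with gcd(i, n) = 1. Let s = 2^{2i} − 2^i + 1, let e be the multiplicative inverse of 2^i + 1 modulo q − 1, and let B = GF(q) ∖ { ((x+1)^s + x^s + 1)^e : x ∈ GF(q) }. Let t be a positive integer with 3t ≡ 2^i + 1 (mod q − 1). Then for all μ ∈ GF(q), f̂_B(μ) = Σ_{x ∈ GF(q)} (−1)^{Tr(x³ + μ^t x)}; equivalently, f̂_B(μ) = f̂_E(μ^t) where E = {x ∈ GF(q) : Tr(x³) = 1}. -/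
open Finset

theorem gcd_two_pow_add_one_sub_one {k n N : ℕ} (hkn : Nat.gcd k n = 1)
    (hN : N ∣ 2 ^ (2 * n) - 1) {d : ℕ} (hd : d ∣ 2 ^ (2 * k) - 1) :
    Nat.gcd d N = if 3 ∣ d then Nat.gcd 3 N else Nat.gcd 1 N := by
  have h3 : Nat.gcd d N ∣ 3 := by
    have h := Nat.pow_sub_one_gcd_pow_sub_one 2 (2 * k) (2 * n)
    rw [Nat.gcd_mul_left, hkn] at h
    have : Nat.gcd d N ∣ Nat.gcd (2 ^ (2 * k) - 1) (2 ^ (2 * n) - 1) :=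
      Nat.gcd_dvd_gcd_of_dvd_left _ hd |>.trans (Nat.gcd_dvd_gcd_of_dvd_right _ hN)
    simpa [h] using this
  split_ifs with h
  · exact Nat.dvd_antisymm (Nat.dvd_gcd h3 (Nat.gcd_dvd_right _ _))
      (Nat.gcd_dvd_gcd_of_dvd_left _ h)
  · rw [Nat.gcd_one_left]
    rcases (Nat.dvd_prime Nat.prime_three).1 h3 with h' | h'
    · exact h'
    · exact absurd (h' ▸ Nat.gcd_dvd_left d N) h

theorem three_dvd_two_pow_add_one_or (k : ℕ) : (3 ∣ 2 ^ k + 1 ∧ ¬ 3 ∣ 2 ^ k - 1) ∨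
    (3 ∣ 2 ^ k - 1 ∧ ¬ 3 ∣ 2 ^ k + 1) := by
  have : 2 ^ k % 3 = 1 ∨ 2 ^ k % 3 = 2 := by
    induction k with
    | zero => simp
    | succ k ih => rw [pow_succ]; omega
  have := Nat.one_le_two_pow (n := k)
  omega

theorem card_pow_eq_of_gcd_eq {M : Type*} [CommGroup M] [Fintype M] [DecidableEq M] {N d d' : ℕ}
    (hM : ∀ s : M, s ^ N = 1) (h : Nat.gcd d N = Nat.gcd d' N) (a : M) :
    #{s : M | s ^ d = a} = #{s : M | s ^ d' = a} := by
  have hex : ∀ {c c' : ℕ}, Nat.gcd c N = Nat.gcd c' N → ∀ s : M, s ^ c = a → ∃ r : M, r ^ c' = a := by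
    intro c c' hc s hs
    have h1 : (s ^ (c / Nat.gcd c N)) ^ Nat.gcd c N = a := by
      rw [← pow_mul, Nat.div_mul_cancel (Nat.gcd_dvd_left _ _), hs]
    rw [hc] at h1
    set r := s ^ (c / Nat.gcd c' N)
    refine ⟨r ^ (Nat.gcdA c' N), ?_⟩
    rw [← h1, ← zpow_natCast r (Nat.gcd c' N), Nat.gcd_eq_gcd_ab, zpow_add, zpow_mul, zpow_mul _ (N : ℤ),
      zpow_natCast, zpow_natCast, hM, one_zpow, mul_one, ← zpow_natCast, ← zpow_mul, mul_comm, zpow_mul,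
      zpow_natCast]
  have hker : ∀ s : M, s ^ d = 1 ↔ s ^ d' = 1 := fun s => by
    have h1 := pow_gcd_eq_one (a := s) (m := d) (n := N)
    have h2 := pow_gcd_eq_one (a := s) (m := d') (n := N)
    rw [h] at h1
    simp only [hM, and_true] at h1 h2
    exact h1.symm.trans h2
  by_cases hs : ∃ s₀ : M, s₀ ^ d = a
  · obtain ⟨s₀, hs₀⟩ := hs
    obtain ⟨r₀, hr₀⟩ := hex h s₀ hs₀
    refine card_bij' (fun s _ => s * s₀⁻¹ * r₀) (fun s _ => s * r₀⁻¹ * s₀) ?_ ?_ ?_ ?_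
    · intro s hs
      simp only [mem_filter, mem_univ, true_and] at hs ⊢
      rw [mul_pow, hr₀, (hker _).1 (by rw [mul_pow, inv_pow, hs, hs₀, mul_inv_cancel]), one_mul]
    · intro s hs
      simp only [mem_filter, mem_univ, true_and] at hs ⊢
      rw [mul_pow, hs₀, (hker _).2 (by rw [mul_pow, inv_pow, hs, hr₀, mul_inv_cancel]), one_mul]
    · intro s _; group
    · intro s _; group
  · have hr : ¬ ∃ r : M, r ^ d' = a := fun ⟨r, hr⟩ => hs (hex h.symm r hr)
    push Not at hs hr
    rw [filter_false_of_mem (fun s _ => hs s), filter_false_of_mem (fun s _ => hr s)]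

/-- In particular, the left-hand side does not depend on `k`. -/
theorem card_pow_two_pow_add_one_eq {M : Type*} [CommGroup M] [Fintype M] [DecidableEq M]
    {n N k : ℕ} (hM : ∀ s : M, s ^ N = 1) (hN : N ∣ 2 ^ (2 * n) - 1) (hkn : Nat.gcd k n = 1)
    (a : M) :
    #{s : M | s ^ (2 ^ k + 1) = a} + #{s : M | s ^ (2 ^ k - 1) = a⁻¹} = #{s : M | s ^ 3 = a} + 1 := by
  have hinv : ∀ d : ℕ, #{s : M | s ^ d = a⁻¹} = #{s : M | s ^ d = a} := fun d =>
    card_bij' (fun s _ => s⁻¹) (fun s _ => s⁻¹) (by simp +contextual) (by simp +contextual)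
      (by simp) (by simp)
  have hfac : (2 ^ k + 1) * (2 ^ k - 1) = 2 ^ (2 * k) - 1 := by
    rw [← Nat.sq_sub_sq, ← pow_mul, mul_comm k, one_pow]
  have hp := gcd_two_pow_add_one_sub_one hkn hN (Dvd.intro _ hfac)
  have hm := gcd_two_pow_add_one_sub_one hkn hN (Dvd.intro_left _ hfac)
  have h1 : #{s : M | s ^ 1 = a} = 1 := by simp [filter_eq']
  rw [hinv]
  rcases three_dvd_two_pow_add_one_or k with ⟨h, h'⟩ | ⟨h, h'⟩
  · rw [if_pos h] at hp
    rw [if_neg h'] at hm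
    rw [card_pow_eq_of_gcd_eq hM hp, card_pow_eq_of_gcd_eq hM hm, h1]
  · rw [if_pos h] at hm
    rw [if_neg h'] at hp
    rw [card_pow_eq_of_gcd_eq hM hp, card_pow_eq_of_gcd_eq hM hm, h1, add_comm]

theorem exists_algebraMap_eq_of_pow_card {F K : Type*} [Field F] [Fintype F] [Field K] [Algebra F K]
    {x : K} (hx : x ^ Fintype.card F = x) : ∃ a : F, algebraMap F K a = x := by
  have hm : (Polynomial.X ^ Fintype.card F - Polynomial.X : Polynomial F).Monic :=
    Polynomial.monic_X_pow_sub (by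
      rw [Polynomial.degree_X]; exact_mod_cast Fintype.one_lt_card)
  have h := Polynomial.prod_multiset_X_sub_C_of_monic_of_roots_card_eq hm (by
    rw [FiniteField.roots_X_pow_card_sub_X, FiniteField.X_pow_card_sub_X_natDegree_eq _
      Fintype.one_lt_card]; rfl)
  rw [FiniteField.roots_X_pow_card_sub_X] at h
  have h' := congrArg (Polynomial.aeval x) h
  change Polynomial.aeval x (∏ a : F, (Polynomial.X - Polynomial.C a)) = _ at h'
  simp only [map_prod, map_sub, map_pow, Polynomial.aeval_X, Polynomial.aeval_C, hx, sub_self,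
    Finset.prod_eq_zero_iff] at h'
  obtain ⟨a, _, ha⟩ := h'
  exact ⟨a, (sub_eq_zero.1 ha).symm⟩

section CharTwoIdentities

variable {K : Type*} [Field K] [CharP K 2] {l m r x : K}

theorem mul_conjugate_eq_one (hl : l ≠ 0) (hm : m ≠ 0) (hlm : l + l⁻¹ = m)
    (h : (r + x) ^ 2 + m * (r * x) + m ^ 2 = 0) :
    (r / m + l * (x / m)) * (r / m + l⁻¹ * (x / m)) = 1 := by
  have hll := mul_inv_cancel₀ hl
  have h1 : (r / m + l * (x / m)) * (r / m + l⁻¹ * (x / m)) =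
      (r ^ 2 + (l + l⁻¹) * (r * x) + l * l⁻¹ * x ^ 2) / m ^ 2 := by ring
  rw [h1, hlm, hll, div_eq_one_iff_eq (pow_ne_zero 2 hm)]
  have h2 := CharTwo.two_eq_zero (R := K)
  linear_combination h - (r * x + m ^ 2) * h2

theorem add_conjugate (hm : m ≠ 0) (hlm : l + l⁻¹ = m) :
    (r / m + l * (x / m)) + (r / m + l⁻¹ * (x / m)) = x := by
  have h2 := CharTwo.two_eq_zero (R := K)
  have h1 : (r / m + l * (x / m)) + (r / m + l⁻¹ * (x / m)) = 2 * (r / m) + (l + l⁻¹) * x / m := by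
    ring
  rw [h1, hlm, h2, zero_mul, zero_add, mul_div_cancel_left₀ _ hm]

theorem eq_mul_div_add (hm : m ≠ 0) : r = m * (r / m + l * (x / m)) + l * x := by
  have h2 := CharTwo.two_eq_zero (R := K)
  have h1 : m * (r / m + l * (x / m)) + l * x = m * (r / m) + l * (m * (x / m)) + l * x := by ring
  rw [h1, mul_div_cancel₀ _ hm, mul_div_cancel₀ _ hm]
  linear_combination -(l * x) * h2

theorem conjugate_decomposition (hm : l + l⁻¹ ≠ 0) :
    (l⁻¹ * x + l * x⁻¹) / (l + l⁻¹) + l * ((x + x⁻¹) / (l + l⁻¹)) = x := by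
  have h2 := CharTwo.two_eq_zero (R := K)
  rw [mul_div_assoc', ← add_div, div_eq_iff hm]
  linear_combination l * x⁻¹ * h2

theorem conic_add_inv (hl : l ≠ 0) (hx : x ≠ 0) :
    ((l⁻¹ * x + l * x⁻¹) + (x + x⁻¹)) ^ 2 +
      (l + l⁻¹) * ((l⁻¹ * x + l * x⁻¹) * (x + x⁻¹)) + (l + l⁻¹) ^ 2 = 0 := by
  have h5 := mul_inv_cancel₀ hx
  have hll := mul_inv_cancel₀ hl
  generalize x⁻¹ = t at *
  generalize l⁻¹ = l' at *
  grind

end CharTwoIdentities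

theorem exists_pow_eq_one_of_add_inv_mem {F K : Type*} [Field F] [Fintype F] [Field K] [Algebra F K]
    [CharP F 2] [CharP K 2] {n : ℕ} (hF : Fintype.card F = 2 ^ n) {m : F} {l : K} (hl : l ≠ 0)
    (hlm : l + l⁻¹ = algebraMap F K m) :
    ∃ N : ℕ, N ≠ 0 ∧ N ∣ 2 ^ (2 * n) - 1 ∧
      (∀ s : K, s ^ N = 1 → (s + s⁻¹) ^ Fintype.card F = s + s⁻¹) ∧
      ∀ a b : F, (algebraMap F K a + l * algebraMap F K b) *
        (algebraMap F K a + l⁻¹ * algebraMap F K b) = 1 →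
        (algebraMap F K a + l * algebraMap F K b) ^ N = 1 := by
  have hadd : ∀ x y : K, (x + y) ^ Fintype.card F = x ^ Fintype.card F + y ^ Fintype.card F := by
    intro x y; rw [hF, add_pow_char_pow]
  have hmap : ∀ a : F, (algebraMap F K a) ^ Fintype.card F = algebraMap F K a := fun a => by
    rw [← map_pow, FiniteField.pow_card]
  have hq : 1 < 2 ^ n := hF ▸ Fintype.one_lt_card
  have hfac : (2 ^ n + 1) * (2 ^ n - 1) = 2 ^ (2 * n) - 1 := by
    rw [← Nat.sq_sub_sq, ← pow_mul, mul_comm n, one_pow]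
  have hlq : l ^ Fintype.card F = l ∨ l ^ Fintype.card F = l⁻¹ := by
    have h1 := hadd l l⁻¹
    rw [hlm, hmap, ← hlm, inv_pow] at h1
    have h2 : l ^ Fintype.card F ≠ 0 := pow_ne_zero _ hl
    have h3 : (l ^ Fintype.card F - l) * (l ^ Fintype.card F - l⁻¹) = 0 := by
      have h4 := mul_inv_cancel₀ h2
      have h5 := mul_inv_cancel₀ hl
      grind
    rcases mul_eq_zero.1 h3 with h | h
    · exact Or.inl (sub_eq_zero.1 h)
    · exact Or.inr (sub_eq_zero.1 h)
  rcases hlq with h | h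
  · refine ⟨2 ^ n - 1, by omega, Dvd.intro_left _ hfac, fun s hs => ?_, fun a b hab => ?_⟩
    · have : s ^ Fintype.card F = s := by
        rw [hF, ← Nat.sub_add_cancel hq.le, pow_succ, hs, one_mul]
      rw [hadd, inv_pow, this]
    · have h0 : algebraMap F K a + l * algebraMap F K b ≠ 0 := left_ne_zero_of_mul_eq_one hab
      apply mul_right_cancel₀ h0
      rw [← pow_succ, Nat.sub_add_cancel hq.le, ← hF, hadd, mul_pow, h, hmap, hmap, one_mul]
  · refine ⟨2 ^ n + 1, by omega, Dvd.intro _ hfac, fun s hs => ?_, fun a b hab => ?_⟩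
    · have : s ^ Fintype.card F = s⁻¹ := by
        rw [pow_succ] at hs
        rw [hF]; exact eq_inv_of_mul_eq_one_left hs
      rw [hadd, inv_pow, this, inv_inv, add_comm]
    · rw [pow_succ, ← hF, hadd, mul_pow, h, hmap, hmap, mul_comm, hab]

theorem card_two_pow_conic_eq_card_rootsOfUnity {F K : Type*} [Field F] [Fintype F]
    [DecidableEq F] [Field K] [DecidableEq K] [Algebra F K] [CharP F 2] [CharP K 2] {m : F} (hm : m ≠ 0)
    {l : K} (hlm : l + l⁻¹ = algebraMap F K m) {N : ℕ} [NeZero N] [Fintype (rootsOfUnity N K)]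
    (hN : Odd N) (hfix : ∀ s : K, s ^ N = 1 → (s + s⁻¹) ^ Fintype.card F = s + s⁻¹)
    (hnorm : ∀ a b : F, (algebraMap F K a + l * algebraMap F K b) *
        (algebraMap F K a + l⁻¹ * algebraMap F K b) = 1 →
        (algebraMap F K a + l * algebraMap F K b) ^ N = 1)
    {a : rootsOfUnity N K} (ha : ((a : Kˣ) : K) = l) (k : ℕ) :
    #{h : F | (h ^ 2 ^ k + h) ^ 2 + m * (h ^ 2 ^ k * h) + m ^ 2 = 0} =
      #{s : rootsOfUnity N K | s ^ (2 ^ k + 1) = a} +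
        #{s : rootsOfUnity N K | s ^ (2 ^ k - 1) = a⁻¹} := by
  have hl : l ≠ 0 := ha ▸ (a : Kˣ).ne_zero
  have hll := mul_inv_cancel₀ hl
  have hM : ∀ s : rootsOfUnity N K, s ^ N = 1 := fun s => Subtype.ext s.2
  have hmK : algebraMap F K m ≠ 0 := by simpa using hm
  have hdisj : Disjoint (filter (fun s : rootsOfUnity N K => s ^ (2 ^ k + 1) = a) univ)
      (filter (fun s : rootsOfUnity N K => s ^ (2 ^ k - 1) = a⁻¹) univ) := by
    rw [disjoint_filter]
    intro s _ h1 h2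
    have h3 : s ^ 2 = a ^ 2 := by
      have : s ^ (2 ^ k + 1) = s ^ (2 ^ k - 1) * s ^ 2 := by
        rw [← pow_add]; congr 1
        have := Nat.one_le_two_pow (n := k); omega
      rw [h1, h2] at this
      rw [pow_two, pow_two a]
      nth_rw 1 [this]
      rw [pow_two, mul_right_comm, inv_mul_cancel, one_mul]
    have hodd : ∀ j x, x ^ 2 ^ j = 1 → ∀ y : rootsOfUnity N K, y = x → y = 1 := by
      rintro j x hx y rfl
      have hc : Nat.gcd (2 ^ j) N = 1 := Nat.Coprime.pow_left _ (Nat.coprime_two_left.2 hN)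
      have := pow_gcd_eq_one.2 ⟨hx, hM y⟩
      rwa [hc, pow_one] at this
    have h4 : s = a := by
      have := hodd 1 (s / a) (by rw [pow_one, div_pow, h3, div_self']) _ rfl
      exact div_eq_one.1 this
    rw [h4, pow_succ] at h1
    have h5 := hodd k a (by simpa using h1) _ rfl
    rw [h5] at ha
    apply hm
    apply (algebraMap F K).injective
    rw [← hlm, ← ha]
    simp [CharTwo.add_self_eq_zero]
  rw [← card_union_of_disjoint hdisj, ← filter_or]
  have hS : ∀ s : rootsOfUnity N K, (s ^ (2 ^ k + 1) = a ∨ s ^ (2 ^ k - 1) = a⁻¹) ↔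
      (((s : Kˣ) : K) ^ 2 ^ k = l * ((s : Kˣ) : K)⁻¹ ∨
        ((s : Kˣ) : K) ^ 2 ^ k = l⁻¹ * ((s : Kˣ) : K)) := by
    intro s
    have h1 : s ^ (2 ^ k + 1) = a ↔ s ^ 2 ^ k = a * s⁻¹ := by
      rw [pow_succ, eq_mul_inv_iff_mul_eq]
    have h2 : s ^ (2 ^ k - 1) = a⁻¹ ↔ s ^ 2 ^ k = a⁻¹ * s := by
      conv_rhs => rw [← Nat.sub_add_cancel (Nat.one_le_two_pow (n := k)), pow_succ]
      simp
    rw [h1, h2]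
    simp only [Subtype.ext_iff, Units.ext_iff, ← ha]
    simp
  have hs_of : ∀ h : F, (h ^ 2 ^ k + h) ^ 2 + m * (h ^ 2 ^ k * h) + m ^ 2 = 0 →
      (algebraMap F K (h ^ 2 ^ k / m) + l * algebraMap F K (h / m)) *
        (algebraMap F K (h ^ 2 ^ k / m) + l⁻¹ * algebraMap F K (h / m)) = 1 := by
    intro h hh
    have := congrArg (algebraMap F K) hh
    simp only [map_add, map_mul, map_pow, map_zero, map_div₀] at this ⊢
    exact mul_conjugate_eq_one hl hmK hlm this
  have hsum : ∀ h : F, (h ^ 2 ^ k + h) ^ 2 + m * (h ^ 2 ^ k * h) + m ^ 2 = 0 →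
      (algebraMap F K (h ^ 2 ^ k / m) + l * algebraMap F K (h / m)) +
        (algebraMap F K (h ^ 2 ^ k / m) + l * algebraMap F K (h / m))⁻¹ = algebraMap F K h := by
    intro h hh
    rw [inv_eq_of_mul_eq_one_right (hs_of h hh)]
    rw [map_div₀, map_div₀]
    exact add_conjugate hmK hlm
  refine card_bij (fun h hh => rootsOfUnity.mkOfPowEq _ (hnorm _ _ (hs_of h (by simpa using hh))))
    ?_ ?_ ?_
  · intro h hh
    simp only [mem_filter, mem_univ, true_and] at hh ⊢
    rw [hS]
    simp only [rootsOfUnity.val_mkOfPowEq_coe]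
    have h1 := hsum h hh
    have h2 := hs_of h hh
    set s := algebraMap F K (h ^ 2 ^ k / m) + l * algebraMap F K (h / m) with hs
    have h0 : s ≠ 0 := left_ne_zero_of_mul_eq_one h2
    have h3 : (algebraMap F K h) ^ 2 ^ k = algebraMap F K m * s + l * algebraMap F K h := by
      rw [hs]
      simp only [map_pow, map_div₀]
      exact eq_mul_div_add hmK
    have h4 : (algebraMap F K h) ^ 2 ^ k = s ^ 2 ^ k + (s ^ 2 ^ k)⁻¹ := by
      rw [← h1, add_pow_char_pow, inv_pow]
    have h5 := mul_inv_cancel₀ h0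
    have h6 := mul_inv_cancel₀ (pow_ne_zero (2 ^ k) h0)
    rw [h4, ← h1, ← hlm] at h3
    have h7 : (s ^ 2 ^ k - l * s⁻¹) * (s ^ 2 ^ k - l⁻¹ * s) = 0 := by
      clear_value s
      clear hS hs_of hsum hs h1 h2 hnorm hfix
      generalize (s ^ 2 ^ k)⁻¹ = u at *
      generalize s ^ 2 ^ k = v at *
      generalize s⁻¹ = t at *
      generalize l⁻¹ = l' at *
      grind
    rcases mul_eq_zero.1 h7 with h | h
    · exact Or.inl (sub_eq_zero.1 h)
    · exact Or.inr (sub_eq_zero.1 h)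
  · intro h₁ hh₁ h₂ hh₂ heq
    simp only [mem_filter, mem_univ, true_and] at hh₁ hh₂
    have := congrArg (fun s : rootsOfUnity N K => ((s : Kˣ) : K)) heq
    simp only [rootsOfUnity.val_mkOfPowEq_coe] at this
    apply (algebraMap F K).injective
    rw [← hsum h₁ hh₁, ← hsum h₂ hh₂, this]
  · intro s hs
    simp only [mem_filter, mem_univ, true_and] at hs
    rw [hS] at hs
    obtain ⟨h, hh⟩ := exists_algebraMap_eq_of_pow_card (F := F) (hfix ((s : Kˣ) : K) (by
      have := congrArg (fun u : Kˣ => (u : K)) ((mem_rootsOfUnity _ _).1 s.2)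
      simpa using this))
    have h0 : ((s : Kˣ) : K) ≠ 0 := (s : Kˣ).ne_zero
    have h6 : (algebraMap F K h) ^ 2 ^ k = l⁻¹ * ((s : Kˣ) : K) + l * ((s : Kˣ) : K)⁻¹ := by
      rw [hh, add_pow_char_pow, inv_pow]
      rcases hs with hs | hs
      · rw [hs, mul_inv, inv_inv, add_comm]
      · rw [hs, mul_inv, inv_inv]
    refine ⟨h, ?_, ?_⟩
    · simp only [mem_filter, mem_univ, true_and]
      apply (algebraMap F K).injective
      simp only [map_add, map_mul, map_pow, map_zero]
      rw [h6, hh, ← hlm]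
      exact conic_add_inv hl h0
    · apply Subtype.ext
      apply Units.ext
      rw [rootsOfUnity.val_mkOfPowEq_coe]
      simp only [map_pow, map_div₀]
      rw [h6, hh]
      rw [← hlm] at hmK ⊢
      exact conjugate_decomposition hmK

theorem card_two_pow_conic_of_isAlgClosed {F : Type*} (K : Type*) [Field F] [Fintype F]
    [DecidableEq F] [CharP F 2] [Field K] [Algebra F K] [IsAlgClosed K] [CharP K 2] {n k : ℕ}
    (hF : Fintype.card F = 2 ^ n) (hkn : Nat.gcd k n = 1) {m : F} (hm : m ≠ 0) :
    #{h : F | (h ^ 2 ^ k + h) ^ 2 + m * (h ^ 2 ^ k * h) + m ^ 2 = 0} =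
      #{h : F | h ^ 3 + h + m = 0} + 1 := by
  classical
  obtain ⟨l, hl⟩ : ∃ l : K, l ^ 2 + algebraMap F K m * l + 1 = 0 := by
    obtain ⟨l, hl⟩ := IsAlgClosed.exists_root
      (Polynomial.X ^ 2 + Polynomial.C (algebraMap F K m) * Polynomial.X + 1)
      (by
        have : (Polynomial.X ^ 2 + Polynomial.C (algebraMap F K m) * Polynomial.X + 1).degree = 2 := by
          compute_degree!
        rw [this]; decide)
    exact ⟨l, by simpa using hl⟩
  have hl0 : l ≠ 0 := by rintro rfl; simp at hl
  have hlm : l + l⁻¹ = algebraMap F K m := by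
    have := mul_inv_cancel₀ hl0
    grind
  obtain ⟨N, hN0, hN, hfix, hnorm⟩ := exists_pow_eq_one_of_add_inv_mem hF hl0 hlm
  have : NeZero N := ⟨hN0⟩
  let _ : Fintype (rootsOfUnity N K) := Fintype.ofFinite _
  have hn : n ≠ 0 := by
    rintro rfl
    have := Fintype.one_lt_card (α := F)
    omega
  have hodd : Odd N := by
    refine Odd.of_dvd_nat ?_ hN
    exact Nat.Even.sub_odd Nat.one_le_two_pow ((Nat.even_pow).2 ⟨even_two, by omega⟩) odd_one
  have hlN : l ^ N = 1 := by simpa using hnorm 0 1 (by simpa using mul_inv_cancel₀ hl0)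
  have hM : ∀ s : rootsOfUnity N K, s ^ N = 1 := fun s => Subtype.ext s.2
  have hcard : ∀ j, Nat.gcd j n = 1 →
      #{h : F | (h ^ 2 ^ j + h) ^ 2 + m * (h ^ 2 ^ j * h) + m ^ 2 = 0} =
        #{s : rootsOfUnity N K | s ^ 3 = rootsOfUnity.mkOfPowEq l hlN} + 1 := fun j hj => by
    rw [card_two_pow_conic_eq_card_rootsOfUnity hm hlm hodd hfix hnorm
      (rootsOfUnity.val_mkOfPowEq_coe _ hlN), card_pow_two_pow_add_one_eq hM hN hj]
  rw [hcard k hkn, ← hcard 1 (Nat.gcd_one_left n), ← card_insert_of_notMem (a := m)]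
  · congr 1
    ext h
    simp only [mem_insert, mem_filter, mem_univ, true_and]
    have : (h ^ 2 ^ 1 + h) ^ 2 + m * (h ^ 2 ^ 1 * h) + m ^ 2 = (h - m) * (h ^ 3 + h + m) := by
      grind
    rw [this, mul_eq_zero, sub_eq_zero]
  · have : m ^ 3 + m + m ≠ 0 := by
      rw [add_assoc, CharTwo.add_self_eq_zero, add_zero]; exact pow_ne_zero 3 hm
    simpa using this

theorem card_two_pow_conic {F : Type*} [Field F] [Fintype F] [DecidableEq F] [CharP F 2] {n k : ℕ}
    (hF : Fintype.card F = 2 ^ n) (hkn : Nat.gcd k n = 1) {m : F} (hm : m ≠ 0) :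
    #{h : F | (h ^ 2 ^ k + h) ^ 2 + m * (h ^ 2 ^ k * h) + m ^ 2 = 0} =
      #{h : F | h ^ 3 + h + m = 0} + 1 :=
  have : CharP (AlgebraicClosure F) 2 :=
    charP_of_injective_algebraMap (algebraMap F (AlgebraicClosure F)).injective 2
  card_two_pow_conic_of_isAlgClosed (AlgebraicClosure F) hF hkn hm

section CharacterSums

variable {F : Type*} [Field F] {ψ : AddChar F ℤ}

theorem addChar_pow_two_pow (hsq : ∀ x, ψ (x ^ 2) = ψ x) (j : ℕ) (x : F) :
    ψ (x ^ 2 ^ j) = ψ x := by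
  induction j with
  | zero => simp
  | succ j ih => rw [pow_succ, pow_mul, hsq, ih]

theorem sq_add_self_eq_zero_iff [CharP F 2] (x : F) : x ^ 2 + x = 0 ↔ x = 0 ∨ x = 1 := by
  rw [show x ^ 2 + x = x * (x + 1) by ring, mul_eq_zero, CharTwo.add_eq_zero]

/-- Cleared-denominator form of the derivative of a Kasami power function. -/
theorem kasami_derivative_mul {k s : ℕ} (hs : s + 2 ^ k = 2 ^ (2 * k) + 1) [CharP F 2] (x : F) :
    ((x + 1) ^ s + x ^ s + 1) * (x ^ 2 + x) ^ 2 ^ k = (x ^ 2 ^ k + x) ^ (2 ^ k + 1) := by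
  have hz : (x ^ 2 + x) ^ 2 ^ k = (x + 1) ^ 2 ^ k * x ^ 2 ^ k := by
    rw [← mul_pow]; ring
  have h1 : (x + 1) ^ s * (x + 1) ^ 2 ^ k = (x ^ 2 ^ (2 * k) + 1) * (x + 1) := by
    rw [← pow_add, hs, pow_succ, add_pow_char_pow, one_pow]
  have h2 : x ^ s * x ^ 2 ^ k = x ^ 2 ^ (2 * k) * x := by
    rw [← pow_add, hs, pow_succ]
  have h3 : (x + 1) ^ 2 ^ k = x ^ 2 ^ k + 1 := by rw [add_pow_char_pow, one_pow]
  have h4 : (x ^ 2 ^ k + x) ^ (2 ^ k + 1) = (x ^ 2 ^ (2 * k) + x ^ 2 ^ k) * (x ^ 2 ^ k + x) := by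
    rw [pow_succ, add_pow_char_pow, ← pow_mul, ← pow_add, two_mul]
  have h5 : ((x + 1) ^ s + x ^ s + 1) * (x ^ 2 + x) ^ 2 ^ k =
      ((x + 1) ^ s * (x + 1) ^ 2 ^ k) * x ^ 2 ^ k + (x ^ s * x ^ 2 ^ k) * (x + 1) ^ 2 ^ k +
        (x + 1) ^ 2 ^ k * x ^ 2 ^ k := by
    rw [hz]; ring
  rw [h5, h1, h2, h3, h4]
  have h2 := CharTwo.two_eq_zero (R := F)
  generalize x ^ 2 ^ (2 * k) = c
  generalize x ^ 2 ^ k = b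
  linear_combination (x * b * c + b) * h2

theorem kasami_derivative_pow_mul {k s e : ℕ} (hs : s + 2 ^ k = 2 ^ (2 * k) + 1)
    (he : ∀ y : F, y ^ ((2 ^ k + 1) * e) = y) [CharP F 2] (x : F) :
    ((x + 1) ^ s + x ^ s + 1) ^ e * ((x ^ 2 + x) ^ e) ^ 2 ^ k = x ^ 2 ^ k + x := by
  rw [← pow_mul, mul_comm e, pow_mul, ← mul_pow, kasami_derivative_mul hs, ← pow_mul, he]

variable [Fintype F]

theorem sum_addChar_comp_mul [DecidableEq F] (hψ : ψ.IsPrimitive) {g : F → F}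
    (hg : Function.Bijective g) (b : F) :
    ∑ x, ψ (g x * b) = if b = 0 then (Fintype.card F : ℤ) else 0 := by
  rw [hg.sum_comp fun x => ψ (x * b), AddChar.sum_mulShift b hψ]
  split_ifs <;> simp

theorem pow_eq_pow_of_modEq_card_sub_one {n a b : ℕ} (hF : Fintype.card F = 2 ^ n) (ha : a ≠ 0)
    (hb : b ≠ 0) (h : a ≡ b [MOD 2 ^ n - 1]) (x : F) : x ^ a = x ^ b := by
  rcases eq_or_ne x 0 with rfl | hx
  · rw [zero_pow ha, zero_pow hb]
  · have h1 : x ^ (2 ^ n - 1) = 1 := by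
      rw [← hF]; exact FiniteField.pow_card_sub_one_eq_one x hx
    rw [pow_eq_pow_mod a h1, pow_eq_pow_mod b h1, h]

/-- A function all of whose correlations with the nontrivial additive characters composed with an
injective map vanish is constant. -/
theorem eq_of_forall_sum_addChar_mul_eq_zero [DecidableEq F] (hψ : ψ.IsPrimitive)
    {g : F → F} (hg : Function.Injective g) {D : F → ℤ}
    (hD : ∀ m : F, m ≠ 0 → ∑ μ, ψ (m * g μ) * D μ = 0) (a b : F) : D a = D b := by
  have key : ∀ a : F, (Fintype.card F : ℤ) * D a = ∑ μ, D μ := by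
    intro a
    have h1 : ∑ m, ψ (-(m * g a)) * ∑ μ, ψ (m * g μ) * D μ = ∑ μ, D μ := by
      rw [sum_eq_single 0 (fun m _ hm => by rw [hD m hm, mul_zero]) (by simp)]
      simp
    rw [← h1]
    simp_rw [mul_sum]
    rw [sum_comm, sum_eq_single a]
    · simp [← mul_assoc, ← AddChar.map_add_eq_mul]
    · intro μ _ hμ
      simp_rw [← mul_assoc, ← AddChar.map_add_eq_mul]
      rw [← sum_mul]
      have h2 : ∀ m, -(m * g a) + m * g μ = m * (g μ - g a) := fun m => by ring
      simp_rw [h2]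
      rw [AddChar.sum_mulShift _ hψ, if_neg (sub_ne_zero.2 (hg.ne hμ))]
      simp
    · simp
  have hq : (Fintype.card F : ℤ) ≠ 0 := by exact_mod_cast Fintype.card_ne_zero
  exact mul_left_cancel₀ hq ((key a).trans (key b).symm)

theorem sum_card_fiber_sub_one_mul_addChar [DecidableEq F] (hψ : ψ.IsPrimitive) (δ : F → F)
    (μ : F) :
    ∑ y, ((#{x | δ x = y} : ℤ) - 1) * ψ (μ * y) =
      if μ = 0 then 0 else ∑ x, ψ (μ * δ x) := by
  have h1 : ∑ y, (#{x | δ x = y} : ℤ) * ψ (μ * y) = ∑ x, ψ (μ * δ x) := by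
    rw [← sum_fiberwise univ δ fun x => ψ (μ * δ x)]
    refine sum_congr rfl fun y _ => ?_
    rw [sum_congr rfl (g := fun _ => ψ (μ * y)) (by simp +contextual), sum_const, nsmul_eq_mul]
  simp_rw [sub_mul, one_mul]
  rw [sum_sub_distrib, h1]
  simp_rw [mul_comm μ _]
  rw [AddChar.sum_mulShift μ hψ]
  split_ifs with h <;> simp [h]

variable [CharP F 2]

theorem bijective_pow_two_pow (j : ℕ) : Function.Bijective fun x : F => x ^ 2 ^ j :=
  Finite.injective_iff_bijective.1 fun x y (h : x ^ 2 ^ j = y ^ 2 ^ j) => by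
    have h1 : (x - y) ^ 2 ^ j = 0 := by rw [sub_pow_char_pow, h, sub_self]
    exact sub_eq_zero.1 ((pow_eq_zero_iff (by positivity)).1 h1)

theorem card_filter_sq_add_self [DecidableEq F] : #{x : F | x ^ 2 + x = 0} = 2 := by
  simp_rw [sq_add_self_eq_zero_iff]
  rw [filter_or, filter_eq' , filter_eq']
  simp

theorem sum_addChar_kasami [DecidableEq F] (hψ : ψ.IsPrimitive) (hsq : ∀ x, ψ (x ^ 2) = ψ x)
    {k s e : ℕ} (hs : s + 2 ^ k = 2 ^ (2 * k) + 1) (he : ∀ y : F, y ^ ((2 ^ k + 1) * e) = y)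
    {m : F} (hm : m ≠ 0) :
    ∑ μ, ψ (m * μ ^ (2 ^ k + 1)) * ∑ x, ψ (μ * ((x + 1) ^ s + x ^ s + 1) ^ e) +
        2 * Fintype.card F =
      Fintype.card F * #{μ : F | m * μ ^ (2 ^ k + 1) + (m * μ ^ (2 ^ k + 1)) ^ 2 +
        μ ^ 2 + μ ^ 2 ^ (k + 1) = 0} := by
  have hbij : Function.Bijective fun μ : F => μ ^ (2 ^ k + 1) :=
    Finite.injective_iff_bijective.1 fun x y (h : x ^ (2 ^ k + 1) = y ^ (2 ^ k + 1)) => by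
      rw [← he x, ← he y, pow_mul, h, ← pow_mul]
  have he0 : e ≠ 0 := by
    rintro rfl; simpa using he 0
  have key : ∀ x : F, ∑ μ, ψ (m * μ ^ (2 ^ k + 1)) * ψ (μ * ((x + 1) ^ s + x ^ s + 1) ^ e) +
      (if x ^ 2 + x = 0 then (Fintype.card F : ℤ) else 0) =
        ∑ μ, ψ (m * μ ^ (2 ^ k + 1) * (x ^ 2 + x) ^ 2 ^ k + μ * (x ^ 2 ^ k + x)) := by
    intro x
    split_ifs with hx
    · have hδ : ((x + 1) ^ s + x ^ s + 1) ^ e = 0 := by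
        have hs0 : s ≠ 0 := by
          rintro rfl
          have := Nat.pow_le_pow_right (n := 2) (by norm_num) (show k ≤ 2 * k by omega)
          omega
        rcases (sq_add_self_eq_zero_iff x).1 hx with rfl | rfl <;>
          simp [CharTwo.add_self_eq_zero, hs0, he0]
      have hx' : x ^ 2 ^ k + x = 0 := by
        rcases (sq_add_self_eq_zero_iff x).1 hx with rfl | rfl <;>
          simp [CharTwo.add_self_eq_zero]
      have := sum_addChar_comp_mul hψ hbij m
      rw [if_neg hm] at this
      simp [hδ, hx, hx', mul_comm m, this]
    · rw [add_zero]
      have hu : (x ^ 2 + x) ^ e ≠ 0 := pow_ne_zero _ hx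
      have hu' : ((x ^ 2 + x) ^ e) ^ 2 ^ k ≠ 0 := pow_ne_zero _ hu
      refine (Equiv.sum_comp (Equiv.mulRight₀ _ hu') _).symm.trans (sum_congr rfl fun μ _ => ?_)
      simp only [Equiv.mulRight₀_apply]
      rw [← AddChar.map_add_eq_mul]
      congr 2
      · rw [mul_pow, ← pow_mul (_ ^ e), mul_comm (2 ^ k), pow_mul (_ ^ e), ← pow_mul _ e,
          mul_comm e, he, mul_assoc]
      · rw [mul_assoc, mul_comm (_ ^ 2 ^ k), kasami_derivative_pow_mul hs he]
  have hinner : ∀ μ : F,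
      ∑ x, ψ (m * μ ^ (2 ^ k + 1) * (x ^ 2 + x) ^ 2 ^ k + μ * (x ^ 2 ^ k + x)) =
        if m * μ ^ (2 ^ k + 1) + (m * μ ^ (2 ^ k + 1)) ^ 2 + μ ^ 2 + μ ^ 2 ^ (k + 1) = 0
          then (Fintype.card F : ℤ) else 0 := by
    intro μ
    rw [← sum_addChar_comp_mul hψ (bijective_pow_two_pow (k + 1))]
    refine sum_congr rfl fun x _ => ?_
    generalize m * μ ^ (2 ^ k + 1) = A
    have h1 : A * (x ^ 2 + x) ^ 2 ^ k + μ * (x ^ 2 ^ k + x) =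
        A * x ^ 2 ^ (k + 1) + A * x ^ 2 ^ k + μ * x ^ 2 ^ k + μ * x := by
      rw [add_pow_char_pow, ← pow_mul, ← pow_succ']; ring
    have h2 : x ^ 2 ^ (k + 1) * (A + A ^ 2 + μ ^ 2 + μ ^ 2 ^ (k + 1)) =
        A * x ^ 2 ^ (k + 1) + (A * x ^ 2 ^ k) ^ 2 + (μ * x ^ 2 ^ k) ^ 2 +
          (μ * x) ^ 2 ^ (k + 1) := by
      simp only [mul_pow, ← pow_mul, ← pow_succ]; ring
    rw [h1, h2]
    simp only [AddChar.map_add_eq_mul, hsq, addChar_pow_two_pow hsq]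
  have hsum := sum_congr rfl fun x (_ : x ∈ (univ : Finset F)) => key x
  rw [sum_add_distrib, ← sum_filter, sum_const, card_filter_sq_add_self, nsmul_eq_mul, sum_comm,
    sum_comm (f := fun x μ => ψ (_ + _)), sum_congr rfl fun μ _ => hinner μ, ← sum_filter,
    sum_const, nsmul_eq_mul] at hsum
  simp_rw [← mul_sum] at hsum
  rw [mul_comm (Fintype.card F : ℤ)]
  exact_mod_cast hsum

theorem sum_addChar_cubic [DecidableEq F] (hψ : ψ.IsPrimitive) (hsq : ∀ x, ψ (x ^ 2) = ψ x)
    (hcube : Function.Bijective fun x : F => x ^ 3) {k t : ℕ}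
    (ht : Function.Bijective fun x : F => x ^ t) (htk : ∀ x : F, (x ^ t) ^ 3 = x ^ (2 ^ k + 1))
    (m : F) :
    ∑ μ, ψ (m * μ ^ (2 ^ k + 1)) * ∑ x, ψ (x ^ 3 + μ ^ t * x) + Fintype.card F =
      Fintype.card F * #{v : F | v ^ 3 + v ^ 2 + m ^ 2 = 0} := by
  have key : ∀ p : F, ψ (m * p ^ 3) * ∑ x, ψ (x ^ 3 + p * x) +
      (if p = 0 then (Fintype.card F : ℤ) else 0) =
        ∑ v, ψ (m * p ^ 3 + (p ^ 3) ^ 2 * v ^ 3 + p ^ 3 * v) := by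
    intro p
    split_ifs with hp
    · have := sum_addChar_comp_mul hψ hcube 1
      simp only [mul_one, one_ne_zero, if_false] at this
      simp [hp, this]
    · rw [add_zero, mul_sum]
      refine (Equiv.sum_comp (Equiv.mulLeft₀ _ (pow_ne_zero 2 hp)) _).symm.trans
        (sum_congr rfl fun v _ => ?_)
      rw [Equiv.mulLeft₀_apply, ← AddChar.map_add_eq_mul]
      congr 1
      ring
  have hinner : ∀ v : F, ∑ w, ψ (m * w + w ^ 2 * v ^ 3 + w * v) =
      if v ^ 3 + v ^ 2 + m ^ 2 = 0 then (Fintype.card F : ℤ) else 0 := by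
    intro v
    rw [← sum_addChar_comp_mul hψ (by simpa using bijective_pow_two_pow (F := F) 1)]
    refine sum_congr rfl fun w _ => ?_
    have h2 : w ^ 2 * (v ^ 3 + v ^ 2 + m ^ 2) = (m * w) ^ 2 + w ^ 2 * v ^ 3 + (w * v) ^ 2 := by
      ring
    rw [h2]
    simp only [AddChar.map_add_eq_mul, hsq]
  have hsum := sum_congr rfl fun x (_ : x ∈ (univ : Finset F)) => key x
  rw [sum_add_distrib, ← sum_filter, sum_const, filter_eq', if_pos (mem_univ _), card_singleton,
    one_nsmul, hcube.sum_comp fun w => ∑ v, ψ (m * w + w ^ 2 * v ^ 3 + w * v), sum_comm,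
    sum_congr rfl fun v _ => hinner v, ← sum_filter, sum_const, nsmul_eq_mul,
    ← ht.sum_comp] at hsum
  simp_rw [htk] at hsum
  rw [hsum, mul_comm]

theorem card_kasami_eq_card_cubic [DecidableEq F] {n k : ℕ} (hF : Fintype.card F = 2 ^ n)
    (hkn : Nat.gcd k n = 1) {m : F} (hm : m ≠ 0) :
    #{μ : F | m * μ ^ (2 ^ k + 1) + (m * μ ^ (2 ^ k + 1)) ^ 2 + μ ^ 2 + μ ^ 2 ^ (k + 1) = 0} =
      #{v : F | v ^ 3 + v ^ 2 + m ^ 2 = 0} + 2 := by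
  have h1 : #{v : F | v ^ 3 + v ^ 2 + m ^ 2 = 0} = #{h : F | h ^ 3 + h + m = 0} := by
    have hid : ∀ h : F, h ≠ 0 → ((m / h) ^ 3 + (m / h) ^ 2 + m ^ 2 = 0 ↔ h ^ 3 + h + m = 0) := by
      intro h hh
      have : (m / h) ^ 3 + (m / h) ^ 2 + m ^ 2 = m ^ 2 / h ^ 3 * (h ^ 3 + h + m) := by
        field_simp; ring
      rw [this, mul_eq_zero, or_iff_right (div_ne_zero (pow_ne_zero _ hm) (pow_ne_zero _ hh))]
    have hne : ∀ h : F, h ^ 3 + h + m = 0 → h ≠ 0 := by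
      rintro h hh rfl; simp [hm] at hh
    have hne' : ∀ v : F, v ^ 3 + v ^ 2 + m ^ 2 = 0 → v ≠ 0 := by
      rintro v hv rfl; simp [hm] at hv
    refine card_bij' (fun v _ => m / v) (fun h _ => m / h) ?_ ?_ ?_ ?_ <;>
      intro v hv <;> simp only [mem_filter, mem_univ, true_and] at hv ⊢
    · rw [← hid _ (div_ne_zero hm (hne' v hv)), div_div_cancel₀ hm]; exact hv
    · exact (hid v (hne v hv)).2 hv
    · exact div_div_cancel₀ hm
    · exact div_div_cancel₀ hm
  have h2 : #{μ : F | m * μ ^ (2 ^ k + 1) + (m * μ ^ (2 ^ k + 1)) ^ 2 + μ ^ 2 +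
      μ ^ 2 ^ (k + 1) = 0} =
      #{h : F | (h ^ 2 ^ k + h) ^ 2 + m * (h ^ 2 ^ k * h) + m ^ 2 = 0} + 1 := by
    have hid : ∀ h : F, h ≠ 0 → (m * h⁻¹ ^ (2 ^ k + 1) + (m * h⁻¹ ^ (2 ^ k + 1)) ^ 2 + h⁻¹ ^ 2 +
        h⁻¹ ^ 2 ^ (k + 1) = 0 ↔ (h ^ 2 ^ k + h) ^ 2 + m * (h ^ 2 ^ k * h) + m ^ 2 = 0) := by
      intro h hh
      have hb : h ^ 2 ^ k ≠ 0 := pow_ne_zero _ hh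
      have : m * h⁻¹ ^ (2 ^ k + 1) + (m * h⁻¹ ^ (2 ^ k + 1)) ^ 2 + h⁻¹ ^ 2 + h⁻¹ ^ 2 ^ (k + 1) =
          ((h ^ 2 ^ k + h) ^ 2 + m * (h ^ 2 ^ k * h) + m ^ 2) / (h ^ 2 ^ k * h) ^ 2 := by
        rw [CharTwo.add_sq, pow_succ h⁻¹ (2 ^ k), pow_succ 2 k, pow_mul h⁻¹]
        simp only [inv_pow]
        generalize h ^ 2 ^ k = b at *
        field_simp
        ring
      rw [this, div_eq_zero_iff, or_iff_left (pow_ne_zero 2 (mul_ne_zero hb hh))]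
    have hne : ∀ h : F, (h ^ 2 ^ k + h) ^ 2 + m * (h ^ 2 ^ k * h) + m ^ 2 = 0 → h ≠ 0 := by
      rintro h hh rfl; simp [hm] at hh
    rw [← card_erase_add_one (a := (0 : F)) (by simp)]
    congr 1
    refine card_bij' (fun v _ => v⁻¹) (fun h _ => h⁻¹) ?_ ?_ ?_ ?_ <;>
      intro v hv <;> simp only [mem_erase, mem_filter, mem_univ, true_and] at hv ⊢
    · rw [← hid _ (inv_ne_zero hv.1), inv_inv]; exact hv.2
    · exact ⟨inv_ne_zero (hne v hv), (hid v (hne v hv)).2 hv⟩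
    · exact inv_inv v
    · exact inv_inv v
  rw [h1, h2, card_two_pow_conic hF hkn hm]

theorem sum_addChar_kasami_eq_sum_addChar_cubic [DecidableEq F] (hψ : ψ.IsPrimitive)
    (hsq : ∀ x, ψ (x ^ 2) = ψ x) {n k s e t : ℕ} (hF : Fintype.card F = 2 ^ n)
    (hkn : Nat.gcd k n = 1) (hs : s + 2 ^ k = 2 ^ (2 * k) + 1)
    (he : ∀ y : F, y ^ ((2 ^ k + 1) * e) = y) (hcube : Function.Bijective fun x : F => x ^ 3)
    (ht : Function.Bijective fun x : F => x ^ t) (htk : ∀ x : F, (x ^ t) ^ 3 = x ^ (2 ^ k + 1))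
    {μ : F} (hμ : μ ≠ 0) :
    ∑ x, ψ (μ * ((x + 1) ^ s + x ^ s + 1) ^ e) = ∑ x, ψ (x ^ 3 + μ ^ t * x) := by
  have hinj : Function.Injective fun μ : F => μ ^ (2 ^ k + 1) :=
    fun x y (h : x ^ (2 ^ k + 1) = y ^ (2 ^ k + 1)) => by
      rw [← he x, ← he y, pow_mul, h, ← pow_mul]
  have ht0 : t ≠ 0 := by
    rintro rfl
    exact zero_ne_one (ht.1 (show (0 : F) ^ 0 = 1 ^ 0 by simp))
  have h0 : ∑ x : F, ψ (x ^ 3) = 0 := by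
    simpa using sum_addChar_comp_mul hψ hcube 1
  have := eq_of_forall_sum_addChar_mul_eq_zero hψ hinj
    (D := fun μ => ∑ x, ψ (μ * ((x + 1) ^ s + x ^ s + 1) ^ e) - ∑ x, ψ (x ^ 3 + μ ^ t * x) -
      if μ = 0 then (Fintype.card F : ℤ) else 0) (fun m hm => ?_) μ 0
  · simpa [hμ, ht0, h0, sub_eq_zero] using this
  · have h1 := sum_addChar_kasami hψ hsq hs he hm
    have h2 := sum_addChar_cubic hψ hsq hcube ht htk m
    have h3 := card_kasami_eq_card_cubic hF hkn hm
    rw [h3] at h1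
    push_cast at h1
    simp only [mul_sub, sum_sub_distrib, mul_ite, mul_zero, sum_ite_eq', mem_univ, if_true]
    simp only [zero_pow (Nat.succ_ne_zero _), mul_zero, AddChar.map_zero_eq_one, one_mul]
    linarith

theorem sum_sq_sum_mul_addChar [DecidableEq F] (hψ : ψ.IsPrimitive) (c : F → ℤ) :
    ∑ μ, (∑ y, c y * ψ (μ * y)) ^ 2 = Fintype.card F * ∑ y, c y ^ 2 := by
  have h1 : ∀ μ, (∑ y, c y * ψ (μ * y)) ^ 2 = ∑ y, ∑ z, c y * c z * ψ (μ * (y + z)) := by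
    intro μ
    rw [sq, sum_mul_sum]
    refine sum_congr rfl fun y _ => sum_congr rfl fun z _ => ?_
    rw [mul_add, AddChar.map_add_eq_mul]; ring
  simp_rw [h1]
  rw [sum_comm, mul_sum]
  refine sum_congr rfl fun y _ => ?_
  rw [sum_comm]
  simp_rw [← mul_sum, AddChar.sum_mulShift _ hψ, CharTwo.add_eq_zero]
  simp; ring

theorem even_card_fiber [DecidableEq F] {δ : F → F} (hδ : ∀ x, δ (x + 1) = δ x) (y : F) :
    Even #{x | δ x = y} := by
  have h : ∑ x ∈ univ.filter (fun x => δ x = y), (1 : ZMod 2) = 0 :=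
    sum_involution (fun x _ => x + 1) (fun _ _ => CharTwo.add_self_eq_zero _)
      (fun x _ _ h => one_ne_zero (left_eq_add.1 h.symm)) (fun x hx => by simpa [hδ] using hx)
      (fun x _ => by rw [add_assoc, CharTwo.add_self_eq_zero, add_zero])
  rw [sum_const, nsmul_eq_mul, mul_one] at h
  exact even_iff_two_dvd.2 ((ZMod.natCast_eq_zero_iff _ 2).1 h)

theorem card_fiber_eq_zero_or_two [DecidableEq F] (hψ : ψ.IsPrimitive) {δ : F → F}
    (hδ : ∀ x, δ (x + 1) = δ x)
    (hsum : ∑ μ, (∑ y, ((#{x | δ x = y} : ℤ) - 1) * ψ (μ * y)) ^ 2 = (Fintype.card F : ℤ) ^ 2)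
    (y : F) : #{x | δ x = y} = 0 ∨ #{x | δ x = y} = 2 := by
  have hq : (Fintype.card F : ℤ) ≠ 0 := by exact_mod_cast Fintype.card_ne_zero
  rw [sum_sq_sum_mul_addChar hψ, sq] at hsum
  have h1 := mul_left_cancel₀ hq hsum
  have h2 : ∑ y, (((#{x | δ x = y} : ℤ) - 1) ^ 2 - 1) = 0 := by
    rw [sum_sub_distrib, h1]; simp
  have h3 : ∀ y ∈ univ, 0 ≤ ((#{x | δ x = y} : ℤ) - 1) ^ 2 - 1 := by
    intro y _
    obtain ⟨r, hr⟩ := even_card_fiber hδ y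
    rw [hr]
    push_cast
    rcases Nat.eq_zero_or_pos r with rfl | h
    · simp
    · have : (1 : ℤ) ≤ r := by exact_mod_cast h
      nlinarith
  have h4 := (sum_eq_zero_iff_of_nonneg h3).1 h2 y (mem_univ y)
  have h5 : (#{x | δ x = y} : ℤ) * (#{x | δ x = y} - 2) = 0 := by linarith
  rcases mul_eq_zero.1 h5 with h | h <;> omega

theorem card_fiber_kasami [DecidableEq F] (hψ : ψ.IsPrimitive)
    (hsq : ∀ x, ψ (x ^ 2) = ψ x) {n k s e t : ℕ} (hF : Fintype.card F = 2 ^ n)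
    (hkn : Nat.gcd k n = 1) (hs : s + 2 ^ k = 2 ^ (2 * k) + 1)
    (he : ∀ y : F, y ^ ((2 ^ k + 1) * e) = y) (hcube : Function.Bijective fun x : F => x ^ 3)
    (ht : Function.Bijective fun x : F => x ^ t) (htk : ∀ x : F, (x ^ t) ^ 3 = x ^ (2 ^ k + 1)) :
    (∀ y : F, #{x : F | ((x + 1) ^ s + x ^ s + 1) ^ e = y} = 0 ∨
      #{x : F | ((x + 1) ^ s + x ^ s + 1) ^ e = y} = 2) ∧
    ∀ μ : F, ∑ y, ((#{x : F | ((x + 1) ^ s + x ^ s + 1) ^ e = y} : ℤ) - 1) * ψ (μ * y) =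
      ∑ x, ψ (x ^ 3 + μ ^ t * x) := by
  have ht0 : t ≠ 0 := by
    rintro rfl
    exact zero_ne_one (ht.1 (show (0 : F) ^ 0 = 1 ^ 0 by simp))
  have hfourier : ∀ μ : F,
      ∑ y, ((#{x : F | ((x + 1) ^ s + x ^ s + 1) ^ e = y} : ℤ) - 1) * ψ (μ * y) =
        ∑ x, ψ (x ^ 3 + μ ^ t * x) := by
    intro μ
    rw [sum_card_fiber_sub_one_mul_addChar hψ]
    split_ifs with h
    · have := sum_addChar_comp_mul hψ hcube 1
      simp only [mul_one, one_ne_zero, if_false] at this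
      simp [h, ht0, this]
    · exact sum_addChar_kasami_eq_sum_addChar_cubic hψ hsq hF hkn hs he hcube ht htk h
  refine ⟨card_fiber_eq_zero_or_two hψ (fun x => ?_) ?_, hfourier⟩
  · rw [add_assoc x 1 1, CharTwo.add_self_eq_zero, add_zero, add_comm (x ^ s)]
  · simp_rw [hfourier]
    rw [ht.sum_comp fun p => (∑ x, ψ (x ^ 3 + p * x)) ^ 2]
    simp_rw [AddChar.map_add_eq_mul]
    rw [sum_sq_sum_mul_addChar hψ, sq]
    simp_rw [sq, ← AddChar.map_add_eq_mul, CharTwo.add_self_eq_zero]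
    simp

end CharacterSums

theorem Tr_sq (n : ℕ) (x : GaloisField 2 n) : Tr n (x ^ 2) = Tr n x := by
  have h := Algebra.trace_eq_of_algEquiv
    (FiniteField.frobeniusAlgEquivOfAlgebraic (ZMod 2) (GaloisField 2 n)) x
  simpa [Tr] using h

theorem neg_one_pow_val_add_s19 (a b : ZMod 2) :
    (-1 : ℤ) ^ (a + b).val = (-1) ^ a.val * (-1) ^ b.val := by
  revert a b; decide

/-- The additive character `x ↦ (-1) ^ Tr x`. -/
noncomputable def traceSignChar (n : ℕ) : AddChar (GaloisField 2 n) ℤ where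
  toFun x := (-1) ^ (Tr n x).val
  map_zero_eq_one' := by simp [Tr]
  map_add_eq_mul' x y := by
    rw [← neg_one_pow_val_add_s19, Tr, map_add]; rfl

theorem traceSignChar_apply (n : ℕ) (x : GaloisField 2 n) :
    traceSignChar n x = (-1) ^ (Tr n x).val := rfl

theorem traceSignChar_isPrimitive (n : ℕ) : (traceSignChar n).IsPrimitive := by
  apply AddChar.IsPrimitive.of_ne_one
  intro h
  obtain ⟨b, hb⟩ := Algebra.trace_surjective (ZMod 2) (GaloisField 2 n) 1
  have h1 : (-1 : ℤ) ^ (Tr n b).val = 1 := by rw [← traceSignChar_apply, h, AddChar.one_apply]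
  rw [Tr, hb] at h1
  exact absurd h1 (by decide)

/-- Lemma 4.1 (Dillon–Dobbertin): for odd `n`, `gcd(i,n) = 1`, `s = 2^{2i} - 2^i + 1`,
`e = 1/(2^i+1) mod 2^n - 1` and `B = GF(q) ∖ {((x+1)^s + x^s + 1)^e : x ∈ GF(q)}`, with
`3t ≡ 2^i + 1 (mod 2^n - 1)`, one has
`f̂_B(μ) = Σ_x (-1)^{Tr(x³ + μ^t x)} = f̂_E(μ^t)` where `E = {x : Tr(x³) = 1}`. -/
theorem stmt_19 (n i s e t : ℕ) (hn : Odd n) (hi : 0 < i) (hgcd : Nat.gcd i n = 1)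
    (hs : s = 2 ^ (2 * i) - 2 ^ i + 1)
    (he0 : 0 < e) (he : (2 ^ i + 1) * e ≡ 1 [MOD 2 ^ n - 1])
    (ht0 : 0 < t) (ht : 3 * t ≡ 2 ^ i + 1 [MOD 2 ^ n - 1])
    (B : Set (GaloisField 2 n))
    (hB : B = Set.univ \
      {y : GaloisField 2 n | ∃ x : GaloisField 2 n, y = ((x + 1) ^ s + x ^ s + 1) ^ e}) :
    ∀ μ : GaloisField 2 n,
      walsh (charFun B) μ
        = (∑ x : GaloisField 2 n, (-1 : ℤ) ^ (Tr n (x ^ 3 + μ ^ t * x)).val) ∧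
      walsh (charFun B) μ
        = walsh (charFun {x : GaloisField 2 n | Tr n (x ^ 3) = 1}) (μ ^ t) := by
  classical
  intro μ
  have hn0 : n ≠ 0 := by rintro rfl; simp at hn
  have hF : Fintype.card (GaloisField 2 n) = 2 ^ n := by
    rw [← Nat.card_eq_fintype_card]; exact GaloisField.card 2 n hn0
  have hpow : ∀ {a b : ℕ}, a ≠ 0 → b ≠ 0 → a ≡ b [MOD 2 ^ n - 1] →
      ∀ x : GaloisField 2 n, x ^ a = x ^ b := fun ha hb h x =>
    pow_eq_pow_of_modEq_card_sub_one hF ha hb h x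
  have hs' : s + 2 ^ i = 2 ^ (2 * i) + 1 := by
    have := Nat.pow_le_pow_right (n := 2) (by norm_num) (show i ≤ 2 * i by omega)
    omega
  have he' : ∀ y : GaloisField 2 n, y ^ ((2 ^ i + 1) * e) = y := fun y => by
    rw [hpow (by positivity) one_ne_zero he, pow_one]
  have htk : ∀ x : GaloisField 2 n, (x ^ t) ^ 3 = x ^ (2 ^ i + 1) := fun x => by
    rw [← pow_mul, mul_comm, hpow (by positivity) (by positivity) ht]
  have htinj : Function.Bijective fun x : GaloisField 2 n => x ^ t :=
    Finite.injective_iff_bijective.1 fun x y (h : x ^ t = y ^ t) => by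
      rw [← he' x, ← he' y, pow_mul, pow_mul y, ← htk, ← htk, h]
  have hcube : Function.Bijective fun x : GaloisField 2 n => x ^ 3 :=
    Finite.injective_iff_bijective.1 fun x y (h : x ^ 3 = y ^ 3) => by
      have h1 : ∀ z : GaloisField 2 n, (z ^ 3) ^ (t * e) = z := fun z => by
        rw [← pow_mul, show 3 * (t * e) = t * 3 * e by ring, pow_mul z, pow_mul z t, htk, ← pow_mul,
          he']
      rw [← h1 x, ← h1 y, h]
  obtain ⟨hN, hfourier⟩ := card_fiber_kasami (traceSignChar_isPrimitive n)
    (fun x => by rw [traceSignChar_apply, traceSignChar_apply, Tr_sq]) hF hgcd hs' he' hcube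
    htinj htk
  have hBmem : ∀ y, y ∈ B ↔ #{x : GaloisField 2 n | ((x + 1) ^ s + x ^ s + 1) ^ e = y} = 0 := by
    intro y
    rw [hB, card_eq_zero, filter_eq_empty_iff]
    simp [eq_comm]
  have hchar : ∀ y, (-1 : ℤ) ^ (charFun B y).val =
      (#{x : GaloisField 2 n | ((x + 1) ^ s + x ^ s + 1) ^ e = y} : ℤ) - 1 := by
    intro y
    have h1 := hBmem y
    unfold charFun
    rcases hN y with h | h
    · rw [if_pos (h1.2 h), h]; rfl
    · rw [if_neg (fun hy => by have := h1.1 hy; omega), h]; rfl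
  have hwalsh : walsh (charFun B) μ =
      ∑ x : GaloisField 2 n, (-1 : ℤ) ^ (Tr n (x ^ 3 + μ ^ t * x)).val := by
    simp_rw [← traceSignChar_apply, ← hfourier, walsh, neg_one_pow_val_add_s19, hchar]
    rfl
  refine ⟨hwalsh, hwalsh.trans (sum_congr rfl fun x _ => ?_)⟩
  have h2 : charFun {x : GaloisField 2 n | Tr n (x ^ 3) = 1} x = Tr n (x ^ 3) := by
    have h3 : ∀ a : ZMod 2, a ≠ 1 → 0 = a := by decide
    unfold charFun
    split_ifs with h
    · exact h.symm
    · exact h3 _ h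
  rw [h2, Tr, map_add]; rfl
end
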